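/- Let p ≥ 1, let S₀ be a real symmetric 2p×2p matrix, and let C = A + B be the sum of two real symmetric 2p×2p matrices A and B each having the same ordered spectrum as S₀. Then C commutes with some hermitian structure J on ℝ^{2p} (i.e. there exists a real 2p×2p matrix J with JᵀJ = I and J² = −I such that JC = CJ) if and only if there exist R ∈ SO(2p) (a real 2p×2p matrix with RᵀR = I and det R = 1) and a hermitian structure J̃ on ℝ^{2p} such that C = R (S₀ + J̃⁻¹S₀J̃) R⁻¹. -/

import Mathlib

open Matrix

theorem MvPolynomial.exists_eval_ne_zero_imp_mem_range {σ τ k : Type*} [Finite σ] [Finite τ]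
    [Field k] [IsAlgClosed k] (f : τ → MvPolynomial σ k)
    (hf : Function.Injective (MvPolynomial.aeval f : MvPolynomial τ k →ₐ[k] MvPolynomial σ k)) :
    ∃ g : MvPolynomial τ k, g ≠ 0 ∧
      ∀ y : τ → k, MvPolynomial.eval y g ≠ 0 → ∃ x, ∀ i, MvPolynomial.eval x (f i) = y i := by
  classical
  let φ : MvPolynomial τ k →+* MvPolynomial σ k := (MvPolynomial.aeval f).toRingHom
  have hφ : φ.FinitePresentation := by
    have h : AlgHom.FinitePresentation
        (MvPolynomial.aeval f : MvPolynomial τ k →ₐ[k] MvPolynomial σ k) := by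
      refine AlgHom.FinitePresentation.of_comp_finiteType
        (Algebra.ofId k (MvPolynomial τ k)) ?_ ?_
      · rw [Subsingleton.elim (AlgHom.comp _ _) (Algebra.ofId k (MvPolynomial σ k))]
        exact (RingHom.finitePresentation_algebraMap (A := k) (B := MvPolynomial σ k)).mpr
          inferInstance
      · exact (RingHom.finiteType_algebraMap (A := k) (B := MvPolynomial τ k)).mpr inferInstance
    exact h
  obtain ⟨S, hS⟩ := PrimeSpectrum.exists_constructibleSetData_iff.mpr
    (PrimeSpectrum.isConstructible_range_comap hφ)
  have hbot : (⊥ : PrimeSpectrum (MvPolynomial τ k)) ∈ S.toSet := by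
    rw [hS]
    refine ⟨⊥, ?_⟩
    ext x
    simp only [PrimeSpectrum.comap_asIdeal, PrimeSpectrum.asIdeal_bot, Ideal.mem_comap,
      Ideal.mem_bot]
    exact map_eq_zero_iff φ hf
  simp only [PrimeSpectrum.ConstructibleSetData.toSet, Set.mem_iUnion] at hbot
  obtain ⟨C, hC, hCbot⟩ := hbot
  have hg0 : ∀ i, C.g i = 0 := by
    intro i
    simpa using hCbot.1 ⟨i, rfl⟩
  have hf0 : C.f ≠ 0 := by
    intro h
    exact hCbot.2 (by simp [h])
  refine ⟨C.f, hf0, fun y hy => ?_⟩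
  let P : PrimeSpectrum (MvPolynomial τ k) :=
    ⟨RingHom.ker (MvPolynomial.eval y), RingHom.ker_isPrime _⟩
  have hP : P ∈ S.toSet := by
    simp only [PrimeSpectrum.ConstructibleSetData.toSet, Set.mem_iUnion]
    refine ⟨C, hC, ?_, ?_⟩
    · rintro _ ⟨i, rfl⟩
      simp [hg0]
    · intro h
      exact hy (by simpa [P] using h)
  rw [hS] at hP
  obtain ⟨Q, hQ⟩ := hP
  obtain ⟨M, hM, hQM⟩ := Ideal.exists_le_maximal Q.asIdeal Q.isPrime.ne_top
  obtain ⟨x, hx⟩ := MvPolynomial.isMaximal_iff_eq_vanishingIdeal_singleton.mp hM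
  refine ⟨x, fun i => ?_⟩
  have h1 : MvPolynomial.X i - MvPolynomial.C (y i) ∈ P.asIdeal := by simp [P]
  rw [← hQ] at h1
  have h2 := hQM h1
  rw [hx, MvPolynomial.mem_vanishingIdeal_singleton_iff] at h2
  simpa [φ, sub_eq_zero, MvPolynomial.aeval_eq_eval] using h2

theorem MvPolynomial.eq_zero_of_eqOn_isOpen {τ : Type*} [Finite τ] (g : MvPolynomial τ ℂ)
    {U : Set (τ → ℂ)} (hU : IsOpen U) (hne : U.Nonempty)
    (h : ∀ y ∈ U, MvPolynomial.eval y g = 0) : g = 0 := by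
  cases nonempty_fintype τ
  obtain ⟨y, hy⟩ := hne
  obtain ⟨ε, hε, hball⟩ := Metric.isOpen_iff.mp hU y hy
  refine MvPolynomial.funext_set (fun i => Metric.ball (y i) ε) (fun i => ?_) fun x hx => ?_
  · exact infinite_of_mem_nhds (y i) (Metric.ball_mem_nhds _ hε)
  · rw [map_zero]
    refine h x (hball ?_)
    rw [ball_pi _ hε]
    exact hx

theorem MvPolynomial.denseRange_eval_of_interior_nonempty {σ τ : Type*} [Finite σ] [Finite τ]
    (f : τ → MvPolynomial σ ℂ)
    (hf : (interior (Set.range fun (x : σ → ℂ) i => MvPolynomial.eval x (f i))).Nonempty) :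
    DenseRange fun (x : σ → ℂ) i => MvPolynomial.eval x (f i) := by
  have hinj : Function.Injective
      (MvPolynomial.aeval f : MvPolynomial τ ℂ →ₐ[ℂ] MvPolynomial σ ℂ) := by
    rw [injective_iff_map_eq_zero]
    intro g hg
    refine MvPolynomial.eq_zero_of_eqOn_isOpen g isOpen_interior hf fun y hy => ?_
    obtain ⟨x, rfl⟩ := interior_subset hy
    have := congrArg (MvPolynomial.eval x) hg
    rw [map_zero, ← MvPolynomial.coe_aeval_eq_eval, RingHom.coe_coe,
      MvPolynomial.comp_aeval_apply] at this
    simpa [MvPolynomial.aeval_eq_eval] using this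
  obtain ⟨g, hg0, hg⟩ := MvPolynomial.exists_eval_ne_zero_imp_mem_range f hinj
  rw [DenseRange, dense_iff_inter_open]
  intro U hU hne
  by_contra hcon
  refine hg0 (MvPolynomial.eq_zero_of_eqOn_isOpen g hU hne fun y hy => ?_)
  by_contra hy0
  obtain ⟨x, hx⟩ := hg y hy0
  exact hcon ⟨y, hy, x, by ext i; exact hx i⟩

section FlagProducts

open scoped Matrix.Norms.L2Operator

variable {n ι : Type*} [Fintype n] [DecidableEq n] [Fintype ι]

/-- The part of a matrix supported on the index pairs `(k, l)` with `w l ≤ w k`. -/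
noncomputable def Matrix.weightUpper {R : Type*} [Zero R] (w : n → ℝ) (Z : Matrix n n R) :
    Matrix n n R :=
  Matrix.of fun k l => if w l ≤ w k then Z k l else 0

omit [Fintype n] in
theorem Matrix.weightUpper_one {R : Type*} [Zero R] [One R] (w : n → ℝ) :
    Matrix.weightUpper w (1 : Matrix n n R) = 1 := by
  ext k l
  by_cases h : k = l <;> simp [Matrix.weightUpper, h, Matrix.one_apply]

/-- Triples `h`, `q`, `r` are sent to the family of products `h qᵢ Uᵢ rᵢ`, where the `qᵢ` are
first made to preserve the range of `P` and the `rᵢ` to preserve the flag of weight `wᵢ`. -/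
noncomputable def flagProduct (P : Matrix n n ℂ) (U : ι → Matrix n n ℂ) (w : ι → n → ℝ)
    (x : Matrix n n ℂ × (ι → Matrix n n ℂ) × (ι → Matrix n n ℂ)) : ι → Matrix n n ℂ :=
  fun i => x.1 * (x.2.1 i - (1 - P) * x.2.1 i * P) * U i * Matrix.weightUpper (w i) (x.2.2 i)

theorem flagProduct_range_mem_nhds (P : Matrix n n ℂ) (hP : P * P = P) (hPt : Pᵀ = P)
    (U : ι → Matrix n n ℂ) (hU : ∀ i, U i * (U i)ᵀ = 1) (w : ι → n → ℝ)
    (hind : ∀ z : ι → Matrix n n ℂ, (∀ i, (1 - P) * z i * P = z i) →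
      (∀ i k l, w i l ≤ w i k → ((U i)ᵀ * z i * U i) k l = 0) → ∑ i, z i = 0 → z = 0) :
    Set.range (flagProduct P U w) ∈ nhds U := by
  let μ : ι → Matrix n n ℂ →L[ℂ] Matrix n n ℂ := fun i => LinearMap.toContinuousLinearMap
    { toFun := Matrix.weightUpper (w i)
      map_add' := fun x y => by
        ext k l
        simp only [Matrix.weightUpper, Matrix.of_apply, Matrix.add_apply]
        split_ifs <;> simp
      map_smul' := fun c y => by
        ext k l; simp [Matrix.weightUpper] }
  have hμ : ∀ i Z, μ i Z = Matrix.weightUpper (w i) Z := fun i Z => rfl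
  let E := Matrix n n ℂ × (ι → Matrix n n ℂ) × (ι → Matrix n n ℂ)
  let p1 : E →L[ℂ] Matrix n n ℂ := ContinuousLinearMap.fst ℂ _ _
  let ν : Matrix n n ℂ →L[ℂ] Matrix n n ℂ := LinearMap.toContinuousLinearMap
    (LinearMap.id - (LinearMap.mulRight ℂ P).comp (LinearMap.mulLeft ℂ (1 - P)))
  have hν : ∀ Z, ν Z = Z - (1 - P) * Z * P := fun Z => rfl
  let p2 : ι → E →L[ℂ] Matrix n n ℂ := fun i => ν.comp <| (ContinuousLinearMap.proj i).comp
    ((ContinuousLinearMap.fst ℂ _ _).comp (ContinuousLinearMap.snd ℂ _ _))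
  let p3 : ι → E →L[ℂ] Matrix n n ℂ := fun i => (μ i).comp ((ContinuousLinearMap.proj i).comp
    ((ContinuousLinearMap.snd ℂ _ _).comp (ContinuousLinearMap.snd ℂ _ _)))
  have e1 : ∀ v, p1 v = v.1 := fun _ => rfl
  have e2 : ∀ i v, p2 i v = v.2.1 i - (1 - P) * v.2.1 i * P := fun _ _ => rfl
  have e3 : ∀ i v, p3 i v = Matrix.weightUpper (w i) (v.2.2 i) := fun _ _ => rfl
  clear_value p1 p2 p3
  let x₀ : E := (1, 1, 1)
  have hder : ∃ L : E →L[ℂ] (ι → Matrix n n ℂ), HasStrictFDerivAt (flagProduct P U w) L x₀ ∧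
      ∀ v i, L v i = v.1 * U i + (v.2.1 i - (1 - P) * v.2.1 i * P) * U i
        + U i * Matrix.weightUpper (w i) (v.2.2 i) := by
    have h1 : HasStrictFDerivAt (fun x : E => x.1) p1 x₀ := by
      simpa only [← e1] using p1.hasStrictFDerivAt
    have h2 : ∀ i, HasStrictFDerivAt (fun x : E => x.2.1 i - (1 - P) * x.2.1 i * P) (p2 i) x₀ := by
      intro i; simpa only [← e2] using (p2 i).hasStrictFDerivAt
    have h3 : ∀ i,
        HasStrictFDerivAt (fun x : E => Matrix.weightUpper (w i) (x.2.2 i)) (p3 i) x₀ := by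
      intro i; simpa only [← e3] using (p3 i).hasStrictFDerivAt
    have h := fun i => ((h1.mul' (h2 i)).mul_const' (U i)).mul' (h3 i)
    refine ⟨_, hasStrictFDerivAt_pi.mpr h, fun v i => ?_⟩
    have hz : (1 - P) * P = 0 := by rw [sub_mul, one_mul, hP, sub_self]
    simp [x₀, e1, e2, e3, Matrix.weightUpper_one, hz]
    abel
  obtain ⟨L, hL, hLv⟩ := hder
  have hx₀ : flagProduct P U w x₀ = U := by
    have hz : (1 - P) * P = 0 := by rw [sub_mul, one_mul, hP, sub_self]
    ext1 i
    simp [flagProduct, x₀, Matrix.weightUpper_one, hz]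
  have hsurj : L.range = ⊤ := by
    by_contra hne
    obtain ⟨φ, hφ0, hφ⟩ := Submodule.exists_le_ker_of_lt_top _ (lt_top_iff_ne_top.mpr hne)
    apply hφ0
    obtain ⟨W, hW⟩ : ∃ W : ι → Matrix n n ℂ, ∀ x, φ x = ∑ i, (W i * x i).trace := by
      classical
      let ψ : ι → Matrix n n ℂ →ₗ[ℂ] ℂ := fun i =>
        φ.comp (LinearMap.single ℂ (fun _ => Matrix n n ℂ) i)
      refine ⟨fun i => Matrix.of fun l k => ψ i (Matrix.single k l 1), fun x => ?_⟩
      have hx : φ x = ∑ i, ψ i (x i) := by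
        conv_lhs => rw [← Finset.univ_sum_single x, map_sum]
        rfl
      rw [hx]
      refine Finset.sum_congr rfl fun i _ => ?_
      conv_lhs => rw [matrix_eq_sum_single (x i)]
      simp only [map_sum, Matrix.trace, Matrix.diag, Matrix.mul_apply, Matrix.of_apply]
      rw [Finset.sum_comm]
      refine Finset.sum_congr rfl fun l _ => Finset.sum_congr rfl fun k _ => ?_
      rw [show Matrix.single k l (x i k l) = x i k l • Matrix.single k l (1 : ℂ) by
        rw [Matrix.smul_single, smul_eq_mul, mul_one], map_smul, smul_eq_mul, mul_comm]
    have hker : ∀ v : E, ∑ i, (W i * (v.1 * U i + (v.2.1 i - (1 - P) * v.2.1 i * P) * U i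
        + U i * Matrix.weightUpper (w i) (v.2.2 i))).trace = 0 := by
      intro v
      have := hφ ⟨v, rfl⟩
      rw [LinearMap.mem_ker, hW] at this
      rw [← this]
      refine Finset.sum_congr rfl fun i _ => ?_
      rw [← hLv]; rfl
    have hU' : ∀ i, (U i)ᵀ * U i = 1 := fun i => mul_eq_one_comm.mp (hU i)
    have hsum : ∑ i, U i * W i = 0 := by
      refine Matrix.ext_iff_trace_mul_right.mpr fun Z => ?_
      rw [zero_mul, Matrix.trace_zero, Finset.sum_mul, Matrix.trace_sum, ← hker (Z, 0, 0)]
      refine Finset.sum_congr rfl fun i _ => ?_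
      simp only [Pi.zero_apply, mul_zero, zero_mul, sub_zero, add_zero, ← hμ, map_zero]
      rw [mul_assoc, Matrix.trace_mul_comm, mul_assoc]
    have hy : ∀ i, U i * W i - P * (U i * W i) * (1 - P) = 0 := by
      classical
      intro i
      refine Matrix.ext_iff_trace_mul_right.mpr fun Z => ?_
      have := hker (0, Pi.single i Z, 0)
      rw [Finset.sum_eq_single_of_mem i (Finset.mem_univ i) (fun j _ hj => by
        simp [Pi.single_eq_of_ne hj, ← hμ])] at this
      simp only [Pi.zero_apply, mul_zero, zero_mul, zero_add, add_zero, ← hμ, map_zero,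
        Pi.single_eq_same] at this
      rw [zero_mul, Matrix.trace_zero, ← this, sub_mul, Matrix.trace_sub, ← mul_assoc (W i),
        Matrix.trace_mul_comm _ (U i), ← mul_assoc (U i) (W i) (_ - _), mul_sub (U i * W i),
        Matrix.trace_sub]
      congr 1
      rw [mul_assoc P, mul_assoc P, Matrix.trace_mul_comm P]
      simp only [mul_assoc]
    have hr : ∀ i k l, w i l ≤ w i k → (W i * U i) l k = 0 := by
      classical
      intro i k l hkl
      have := hker (0, 0, Pi.single i (Matrix.single k l 1))
      rw [Finset.sum_eq_single_of_mem i (Finset.mem_univ i) (fun j _ hj => by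
        simp [Pi.single_eq_of_ne hj, ← hμ])] at this
      simp only [Pi.zero_apply, mul_zero, zero_mul, zero_add, sub_zero, Pi.single_eq_same] at this
      have hs : Matrix.weightUpper (w i) (Matrix.single k l (1 : ℂ)) = Matrix.single k l 1 := by
        ext a b
        simp only [Matrix.weightUpper, Matrix.of_apply]
        split_ifs with hab
        · rfl
        · rw [Matrix.single_apply, if_neg]
          rintro ⟨rfl, rfl⟩
          exact hab hkl
      rw [hs, ← mul_assoc, Matrix.trace_mul_single] at this
      simpa using this
    have hW0 : (fun i => (U i * W i)ᵀ) = 0 := by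
      refine hind _ (fun i => ?_) (fun i k l hkl => ?_) ?_
      · have := congrArg Matrix.transpose (sub_eq_zero.mp (hy i))
        simpa only [Matrix.transpose_mul, Matrix.transpose_sub, Matrix.transpose_one, hPt,
          mul_assoc] using this.symm
      · have : (U i)ᵀ * (U i * W i)ᵀ * U i = (W i * U i)ᵀ := by
          rw [Matrix.transpose_mul, mul_assoc, mul_assoc, hU', mul_one, Matrix.transpose_mul]
        rw [this, Matrix.transpose_apply, hr i k l hkl]
      · rw [← Matrix.transpose_sum, hsum, Matrix.transpose_zero]
    ext x
    rw [hW]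
    refine Finset.sum_eq_zero fun i _ => ?_
    have : W i = 0 := by
      have h := congrArg Matrix.transpose (congrFun hW0 i)
      simp only [Matrix.transpose_transpose, Pi.zero_apply, Matrix.transpose_zero] at h
      rw [← one_mul (W i), ← hU', mul_assoc, h, mul_zero]
    rw [this, zero_mul, Matrix.trace_zero]
  have := hL.map_nhds_eq_of_surj hsurj
  rw [hx₀] at this
  rw [← this]
  exact Filter.mem_map.mpr (Filter.univ_mem' fun x => ⟨x, rfl⟩)

end FlagProducts

section FlagProductsDense

variable {n ι : Type*} [Fintype n] [DecidableEq n] [Fintype ι]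

theorem denseRange_flagProduct (P : Matrix n n ℂ) (U : ι → Matrix n n ℂ) (w : ι → n → ℝ)
    (h : Set.range (flagProduct P U w) ∈ nhds U) : DenseRange (flagProduct P U w) := by
  let σ := (n × n) ⊕ (ι × n × n) ⊕ (ι × n × n)
  let H : Matrix n n (MvPolynomial σ ℂ) := of fun k l => MvPolynomial.X (Sum.inl (k, l))
  let Q : ι → Matrix n n (MvPolynomial σ ℂ) := fun i =>
    of fun k l => MvPolynomial.X (Sum.inr (Sum.inl (i, k, l)))
  let R : ι → Matrix n n (MvPolynomial σ ℂ) := fun i =>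
    of fun k l => MvPolynomial.X (Sum.inr (Sum.inr (i, k, l)))
  let c : Matrix n n ℂ → Matrix n n (MvPolynomial σ ℂ) := MvPolynomial.C.mapMatrix
  let F : ι × n × n → MvPolynomial σ ℂ := fun t =>
    (H * (Q t.1 - (1 - c P) * Q t.1 * c P) * c (U t.1) * Matrix.weightUpper (w t.1) (R t.1))
      t.2.1 t.2.2
  let s : (σ → ℂ) → Matrix n n ℂ × (ι → Matrix n n ℂ) × (ι → Matrix n n ℂ) := fun x =>
    (of fun k l => x (Sum.inl (k, l)), fun i => of fun k l => x (Sum.inr (Sum.inl (i, k, l))),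
      fun i => of fun k l => x (Sum.inr (Sum.inr (i, k, l))))
  have hF : ∀ x i k l, MvPolynomial.eval x (F (i, k, l)) = flagProduct P U w (s x) i k l := by
    intro x i k l
    have hc : ∀ M : Matrix n n ℂ, (MvPolynomial.eval x).mapMatrix (c M) = M := by
      intro M; ext a b; simp [c]
    have hH : (MvPolynomial.eval x).mapMatrix H = (s x).1 := by ext a b; simp [H, s]
    have hQ : (MvPolynomial.eval x).mapMatrix (Q i) = (s x).2.1 i := by ext a b; simp [Q, s]
    have hR : (MvPolynomial.eval x).mapMatrix (Matrix.weightUpper (w i) (R i))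
        = Matrix.weightUpper (w i) ((s x).2.2 i) := by
      ext a b
      simp only [Matrix.weightUpper, RingHom.mapMatrix_apply, Matrix.map_apply, Matrix.of_apply]
      split_ifs <;> simp [R, s]
    change (MvPolynomial.eval x).mapMatrix _ k l = _
    simp only [map_mul, map_sub, map_one, hc, hH, hQ, hR, flagProduct]
  let e : (ι × n × n → ℂ) ≃ₜ (ι → Matrix n n ℂ) :=
    { toFun := fun x i => of fun k l => x (i, k, l)
      invFun := fun y t => y t.1 t.2.1 t.2.2
      left_inv := fun _ => rfl
      right_inv := fun _ => rfl
      continuous_toFun := by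
        refine continuous_pi fun i => continuous_pi fun k => continuous_pi fun l => ?_
        exact continuous_apply (i, k, l)
      continuous_invFun := by
        refine continuous_pi fun t => ?_
        exact (continuous_apply t.2.2).comp ((continuous_apply t.2.1).comp (continuous_apply t.1)) }
  have hs : Function.Surjective s := fun y =>
    ⟨Sum.elim (fun t => y.1 t.1 t.2)
      (Sum.elim (fun t => y.2.1 t.1 t.2.1 t.2.2) fun t => y.2.2 t.1 t.2.1 t.2.2), rfl⟩
  have hcomp : (e ∘ fun x t => MvPolynomial.eval x (F t)) = flagProduct P U w ∘ s := by
    funext x i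
    ext k l
    exact hF x i k l
  have hr : Set.range (flagProduct P U w) =
      e '' Set.range fun x t => MvPolynomial.eval x (F t) := by
    rw [← Set.range_comp, hcomp, hs.range_comp]
  have hint : (interior (Set.range fun (x : σ → ℂ) t => MvPolynomial.eval x (F t))).Nonempty := by
    have hU := mem_interior_iff_mem_nhds.mpr h
    rw [hr, ← e.image_interior] at hU
    obtain ⟨x, hx, -⟩ := hU
    exact ⟨x, hx⟩
  have hd := (MvPolynomial.denseRange_eval_of_interior_nonempty F hint)
  have := e.surjective.denseRange.comp hd e.continuous
  rw [hcomp] at this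
  exact this.mono (Set.range_comp_subset_range _ _)

end FlagProductsDense

section Projections

variable {n : Type*} [Fintype n] [DecidableEq n]

theorem Matrix.exists_isStarProjection_range (M : Matrix n n ℂ) :
    ∃ Y : Matrix n n ℂ, IsStarProjection Y ∧ Y * M = M ∧ (∀ X, X * M = M → X * Y = Y) ∧
      Y.trace = M.rank := by
  let Φ := Matrix.toEuclideanCLM (n := n) (𝕜 := ℂ)
  let K := LinearMap.range (Φ M : EuclideanSpace ℂ n →ₗ[ℂ] EuclideanSpace ℂ n)
  obtain ⟨Y, hY⟩ : ∃ Y, Φ Y = K.starProjection := Φ.surjective _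
  have hmul : ∀ A B, Φ (A * B) = Φ A * Φ B := fun A B => map_mul Φ A B
  have hinj : ∀ A B, Φ A = Φ B → A = B := fun A B h => Φ.injective h
  have hYx : ∀ x, ∃ y, Φ M y = Φ Y x := fun x => by
    rw [hY]
    exact Submodule.starProjection_apply_mem K x
  have hYM : Y * M = M := by
    refine hinj _ _ ?_
    rw [hmul, hY]
    ext1 x
    exact Submodule.starProjection_eq_self_iff.mpr ⟨x, rfl⟩
  refine ⟨Y, ⟨hinj _ _ ?_, hinj _ _ ?_⟩, hYM, fun X hX => hinj _ _ ?_, ?_⟩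
  · rw [hmul, hY]
    exact (isStarProjection_starProjection (U := K)).isIdempotentElem
  · rw [show Φ (star Y) = star (Φ Y) from map_star Φ Y, hY]
    exact (isStarProjection_starProjection (U := K)).isSelfAdjoint
  · rw [hmul]
    ext1 x
    obtain ⟨y, hy⟩ := hYx x
    rw [mul_apply_eq_comp, ← hy]
    have := congrArg Φ hX
    rw [hmul] at this
    exact congrArg (fun f => f y) this
  · have hp : LinearMap.IsProj (LinearMap.range M.mulVecLin) (Matrix.toLin' Y) := by
      constructor
      · intro x
        obtain ⟨y, hy⟩ := hYx (WithLp.toLp 2 x)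
        exact ⟨WithLp.ofLp y, congrArg WithLp.ofLp hy⟩
      · rintro _ ⟨x, rfl⟩
        change Y *ᵥ (M *ᵥ x) = M *ᵥ x
        rw [Matrix.mulVec_mulVec, hYM]
    rw [← Matrix.trace_toLin'_eq, hp.trace]
    rfl

omit [DecidableEq n] in
theorem IsStarProjection.re_trace_mul_nonneg {p q : Matrix n n ℂ} (hp : IsStarProjection p)
    (hq : IsStarProjection q) : 0 ≤ (p * q).trace.re := by
  have h : (p * q).trace = ((q * p)ᴴ * (q * p)).trace := by
    rw [conjTranspose_mul, ← star_eq_conjTranspose, ← star_eq_conjTranspose,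
      hp.isSelfAdjoint.star_eq, hq.isSelfAdjoint.star_eq, mul_assoc, ← mul_assoc q q,
      hq.isIdempotentElem.eq, Matrix.trace_mul_comm p (q * p), mul_assoc,
      hp.isIdempotentElem.eq, Matrix.trace_mul_comm]
  rw [h]
  open scoped ComplexOrder in
  have := Matrix.PosSemidef.trace_nonneg (Matrix.posSemidef_conjTranspose_mul_self (q * p))
  exact (Complex.le_def.mp this).1

theorem IsStarProjection.sub_of_mul_eq {R : Type*} [Ring R] [StarRing R] {p y : R}
    (hp : IsStarProjection p) (hy : IsStarProjection y) (hpy : p * y = y) :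
    IsStarProjection (p - y) := by
  have hyp : y * p = y := by
    have := congrArg star hpy
    rwa [star_mul, hp.isSelfAdjoint.star_eq, hy.isSelfAdjoint.star_eq] at this
  refine ⟨?_, hp.isSelfAdjoint.sub hy.isSelfAdjoint⟩
  rw [IsIdempotentElem, sub_mul, mul_sub, mul_sub, hpy, hyp, hy.isIdempotentElem.eq,
    hp.isIdempotentElem.eq]
  abel

theorem IsStarProjection.re_trace_le_of_mul_eq {p q y : Matrix n n ℂ} (hp : IsStarProjection p)
    (hq : IsStarProjection q) (hy : IsStarProjection y) (hpy : p * y = y) (hqy : q * y = y) :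
    y.trace.re ≤ (p * q).trace.re := by
  have h := (hp.sub_of_mul_eq hy hpy).re_trace_mul_nonneg (hq.sub_of_mul_eq hy hqy)
  have e : (p - y) * (q - y) = p * q - y * q - y + y := by
    rw [sub_mul, mul_sub, mul_sub, hpy, hy.isIdempotentElem.eq]
    abel
  have e2 : (y * q).trace = y.trace := by rw [trace_mul_comm, hqy]
  rw [e] at h
  simp only [trace_add, trace_sub, e2, Complex.add_re, Complex.sub_re] at h
  linarith

theorem IsStarProjection.eq_of_mul_eq_of_trace_eq {q y : Matrix n n ℂ}
    (hq : IsStarProjection q) (hy : IsStarProjection y) (hqy : q * y = y)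
    (ht : q.trace = y.trace) : q = y := by
  have h := hq.sub_of_mul_eq hy hqy
  open scoped ComplexOrder in
  rw [← sub_eq_zero, ← Matrix.trace_conjTranspose_mul_self_eq_zero_iff,
    ← star_eq_conjTranspose, h.isSelfAdjoint.star_eq, h.isIdempotentElem.eq, trace_sub, ht,
    sub_self]

open scoped Matrix.Norms.L2Operator in
theorem Matrix.isCompact_setOf_isStarProjection :
    IsCompact {p : Matrix n n ℂ | IsStarProjection p} := by
  have : ProperSpace (Matrix n n ℂ) := FiniteDimensional.proper ℂ _
  refine Metric.isCompact_of_isClosed_isBounded ?_ ?_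
  · have : {p : Matrix n n ℂ | IsStarProjection p} = {p | p * p = p} ∩ {p | star p = p} := by
      ext p
      exact ⟨fun h => ⟨h.1, h.2⟩, fun h => ⟨h.1, h.2⟩⟩
    rw [this]
    exact (isClosed_eq (by fun_prop) continuous_id).inter (isClosed_eq (by fun_prop) continuous_id)
  · refine (Metric.isBounded_closedBall (x := 0) (r := 1)).subset fun p hp => ?_
    rw [mem_closedBall_zero_iff]
    exact hp.norm_le

end Projections

theorem Finset.sum_sub_mul_nonneg_of_upper_sums_nonneg {n : Type*} [DecidableEq n] (a v : n → ℝ)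
    (s : Finset n) (h : ∀ k ∈ s, 0 ≤ ∑ l ∈ s with a k ≤ a l, v l) (c : ℝ)
    (hc : ∀ k ∈ s, c ≤ a k) : 0 ≤ ∑ l ∈ s, (a l - c) * v l := by
  induction s using Finset.strongInduction generalizing c with
  | H s ih =>
    rcases s.eq_empty_or_nonempty with rfl | hs
    · simp
    obtain ⟨k, hk, hmin⟩ := s.exists_min_image a hs
    have hsum : 0 ≤ ∑ l ∈ s, v l := by
      have := h k hk
      rwa [Finset.filter_true_of_mem hmin] at this
    have hss : s.filter (fun l => a k < a l) ⊂ s :=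
      Finset.filter_ssubset.mpr ⟨k, hk, lt_irrefl _⟩
    have hI := ih _ hss (fun j hj => ?_) (a k) (fun j hj => (Finset.mem_filter.mp hj).2.le)
    · have e1 : ∑ l ∈ s with a k < a l, (a l - a k) * v l = ∑ l ∈ s, (a l - a k) * v l := by
        refine Finset.sum_subset (Finset.filter_subset _ _) fun l hl hl' => ?_
        have : a l = a k := by
          refine le_antisymm (not_lt.mp fun hlt => hl' ?_) (hmin l hl)
          exact Finset.mem_filter.mpr ⟨hl, hlt⟩
        rw [this, sub_self, zero_mul]
      have e2 : ∑ l ∈ s, (a l - c) * v l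
          = ∑ l ∈ s, (a l - a k) * v l + (a k - c) * ∑ l ∈ s, v l := by
        rw [Finset.mul_sum, ← Finset.sum_add_distrib]
        exact Finset.sum_congr rfl fun l _ => by ring
      rw [e2, ← e1]
      exact add_nonneg hI (mul_nonneg (sub_nonneg.mpr (hc k hk)) hsum)
    · have hj' := Finset.mem_filter.mp hj
      have := h j hj'.1
      rwa [Finset.filter_filter, Finset.filter_congr (q := fun l => a j ≤ a l)]
      exact fun l _ => ⟨fun hl => hl.2, fun hl => ⟨hj'.2.trans_le hl, hl⟩⟩

section FlagProjections

variable {n ι : Type*} [Fintype n] [DecidableEq n] [Fintype ι]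

/-- The coordinate projection onto the indices of weight at least `s`. -/
noncomputable def upperProj (w : n → ℝ) (s : ℝ) : Matrix n n ℂ :=
  diagonal fun k => if s ≤ w k then 1 else 0

/-- The coordinate projection onto the indices in `S`. -/
noncomputable def coordProj (S : Finset n) : Matrix n n ℂ :=
  diagonal fun k => if k ∈ S then 1 else 0

theorem rank_coordProj (S : Finset n) : (coordProj S).rank = S.card := by
  rw [coordProj, Matrix.rank_diagonal]
  simp

theorem upperProj_eq (w : n → ℝ) (s : ℝ) :
    upperProj w s = coordProj (Finset.univ.filter fun k => s ≤ w k) := by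
  simp [upperProj, coordProj]

theorem coordProj_mul (S T : Finset n) : coordProj S * coordProj T = coordProj (S ∩ T) := by
  simp only [coordProj, diagonal_mul_diagonal, Finset.mem_inter]
  congr 1
  ext k
  by_cases h1 : k ∈ S <;> by_cases h2 : k ∈ T <;> simp [h1, h2]

theorem isStarProjection_coordProj (S : Finset n) : IsStarProjection (coordProj S) := by
  refine ⟨by rw [IsIdempotentElem, coordProj_mul, Finset.inter_self], ?_⟩
  rw [IsSelfAdjoint, star_eq_conjTranspose, coordProj, diagonal_conjTranspose]
  congr 1
  ext k
  simp [apply_ite]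

theorem trace_coordProj (S : Finset n) : (coordProj S).trace = S.card := by
  simp [coordProj, trace]

theorem weightUpper_mul_upperProj (w : n → ℝ) (Z : Matrix n n ℂ)
    (hZ : IsUnit (weightUpper w Z).det) (s : ℝ) :
    ∃ X, upperProj w s = weightUpper w Z * upperProj w s * X := by
  have hb : BlockTriangular (weightUpper w Z) (OrderDual.toDual ∘ w) := by
    intro i j hij
    have : w i < w j := hij
    simp [weightUpper, not_le.mpr this]
  have := Matrix.invertibleOfIsUnitDet _ hZ
  have hi := blockTriangular_inv_of_blockTriangular hb
  refine ⟨(weightUpper w Z)⁻¹ * upperProj w s, ?_⟩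
  have h1 : upperProj w s * ((weightUpper w Z)⁻¹ * upperProj w s)
      = (weightUpper w Z)⁻¹ * upperProj w s := by
    ext k l
    simp only [upperProj, diagonal_mul, mul_diagonal]
    by_cases hk : s ≤ w k
    · simp [hk]
    by_cases hl : s ≤ w l
    · have : (weightUpper w Z)⁻¹ k l = 0 := hi (show w k < w l by linarith)
      simp [this]
    · simp [hl]
  rw [mul_assoc, h1, ← mul_assoc, Matrix.mul_nonsing_inv _ hZ, one_mul]

omit [Fintype ι] in
theorem flagProduct_exists_projections [Nonempty ι] (P : Matrix n n ℂ) (hP : P * P = P)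
    (U : ι → Matrix n n ℂ) (S : ι → Finset n) (hS : ∀ i, P * U i = U i * coordProj (S i))
    (w : ι → n → ℝ) (x) (hx : ∀ i, (flagProduct P U w x i).det ≠ 0) :
    ∃ (p : Matrix n n ℂ) (Q : ι → n → Matrix n n ℂ), IsStarProjection p ∧
      (∀ i k, IsStarProjection (Q i k)) ∧ p.trace = P.rank ∧
      (∀ i k, Q i k * (flagProduct P U w x i * upperProj (w i) (w i k))
        = flagProduct P U w x i * upperProj (w i) (w i k)) ∧
      (∀ i k, (Q i k).trace = (upperProj (w i) (w i k)).trace) ∧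
      ∀ i k, ((S i ∩ Finset.univ.filter fun l => w i k ≤ w i l).card : ℝ) ≤
        (p * Q i k).trace.re := by
  obtain ⟨h, q, r⟩ := x
  set g := flagProduct P U w (h, q, r) with hg
  let q' : ι → Matrix n n ℂ := fun i => q i - (1 - P) * q i * P
  have hq' : ∀ i, q' i * P = P * (q' i * P) := by
    intro i
    have : q' i * P = P * q i * P := by
      simp only [q']
      rw [sub_mul, mul_assoc ((1 - P) * q i), hP]
      noncomm_ring
    rw [this, ← mul_assoc, ← mul_assoc, hP]
  have hgi : ∀ i, g i = h * q' i * U i * weightUpper (w i) (r i) := fun i => rfl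
  have hdet : ∀ i, IsUnit (h * q' i * U i).det ∧ IsUnit (weightUpper (w i) (r i)).det ∧
      IsUnit h.det := by
    intro i
    have := hx i
    simp only [hgi, det_mul, mul_ne_zero_iff] at this
    simp only [det_mul, isUnit_iff_ne_zero, mul_ne_zero_iff]
    tauto
  obtain ⟨p, hp, hpM, hpX, hpt⟩ := Matrix.exists_isStarProjection_range (h * P)
  choose Q hQ hQM hQX hQt using fun i k =>
    Matrix.exists_isStarProjection_range (g i * upperProj (w i) (w i k))
  refine ⟨p, Q, hp, hQ, ?_, hQM, ?_, ?_⟩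
  · obtain ⟨i⟩ := ‹Nonempty ι›
    rw [hpt, Matrix.rank_mul_eq_right_of_isUnit_det _ _ (hdet i).2.2]
  · intro i k
    rw [hQt, Matrix.rank_mul_eq_right_of_isUnit_det _ _ (isUnit_iff_ne_zero.mpr (hx i)),
      upperProj_eq, rank_coordProj, trace_coordProj]
  · intro i k
    set D := upperProj (w i) (w i k) with hD
    obtain ⟨y, hy, hyM, hyX, hyt⟩ :=
      Matrix.exists_isStarProjection_range (h * q' i * U i * (coordProj (S i) * D))
    have h1 : p * y = y := by
      refine hyX _ ?_
      have e : h * q' i * U i * (coordProj (S i) * D) = h * P * (q' i * P * U i * D) := by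
        calc h * q' i * U i * (coordProj (S i) * D)
          _ = h * (q' i * ((U i * coordProj (S i)) * D)) := by
              simp only [mul_assoc]
          _ = h * ((q' i * P) * U i * D) := by rw [← hS]; simp only [mul_assoc]
          _ = h * (P * (q' i * P) * U i * D) := by rw [← hq']
          _ = _ := by simp only [mul_assoc]
      rw [e, ← mul_assoc, hpM]
    have h2 : Q i k * y = y := by
      refine hyX _ ?_
      obtain ⟨X, hX⟩ := weightUpper_mul_upperProj (w i) (r i) (hdet i).2.1 (w i k)
      have e : h * q' i * U i * (coordProj (S i) * D) = g i * D * (X * coordProj (S i)) := by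
        have hc : coordProj (S i) * D = D * coordProj (S i) := by
          rw [hD, upperProj_eq, coordProj_mul, coordProj_mul, Finset.inter_comm]
        rw [hc]
        conv_lhs => rw [hD, hX]
        rw [hgi]
        simp only [mul_assoc, hD]
      rw [e, ← mul_assoc, hQM]
    have h3 := hp.re_trace_le_of_mul_eq (hQ i k) hy h1 h2
    rw [hyt, Matrix.rank_mul_eq_right_of_isUnit_det _ _ (hdet i).1, hD, upperProj_eq,
      coordProj_mul, rank_coordProj] at h3
    simpa using h3

theorem exists_isStarProjection_weighted_trace_le [Nonempty ι] (P : Matrix n n ℂ)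
    (hP : P * P = P) (hPt : Pᵀ = P) (U : ι → Matrix n n ℂ) (hU : ∀ i, U i * (U i)ᵀ = 1)
    (S : ι → Finset n) (hS : ∀ i, P * U i = U i * coordProj (S i)) (w : ι → n → ℝ)
    (hind : ∀ z : ι → Matrix n n ℂ, (∀ i, (1 - P) * z i * P = z i) →
      (∀ i k l, w i l ≤ w i k → ((U i)ᵀ * z i * U i) k l = 0) → ∑ i, z i = 0 → z = 0)
    (V : ι → Matrix n n ℂ) (hV : ∀ i, (V i)ᴴ * V i = 1) :
    ∃ p : Matrix n n ℂ, ∀ i, ∑ k ∈ S i, w i k ≤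
      (p * (V i * diagonal (fun k => (w i k : ℂ)) * (V i)ᴴ)).trace.re := by
  let K := {p : Matrix n n ℂ | IsStarProjection p}
  have : CompactSpace K := isCompact_iff_compactSpace.mp Matrix.isCompact_setOf_isStarProjection
  let D : ι → n → Matrix n n ℂ := fun i k => upperProj (w i) (w i k)
  let c : ι → n → ℝ := fun i k => ((S i ∩ Finset.univ.filter fun l => w i k ≤ w i l).card : ℝ)
  let Z : Set ((K × (ι → n → K)) × (ι → Matrix n n ℂ)) := {t |
    (t.1.1 : Matrix n n ℂ).trace = P.rank ∧
    (∀ i k, (t.1.2 i k : Matrix n n ℂ) * (t.2 i * D i k) = t.2 i * D i k) ∧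
    (∀ i k, (t.1.2 i k : Matrix n n ℂ).trace = (D i k).trace) ∧
    ∀ i k, c i k ≤ ((t.1.1 : Matrix n n ℂ) * (t.1.2 i k : Matrix n n ℂ)).trace.re}
  have hQc : ∀ i k, Continuous fun t : (K × (ι → n → K)) × (ι → Matrix n n ℂ) =>
      (t.1.2 i k : Matrix n n ℂ) := fun i k => by fun_prop
  have hZ : IsClosed Z := by
    have hZi : Z = {t | (t.1.1 : Matrix n n ℂ).trace = P.rank} ∩
        ((⋂ i, ⋂ k, {t | (t.1.2 i k : Matrix n n ℂ) * (t.2 i * D i k) = t.2 i * D i k}) ∩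
        ((⋂ i, ⋂ k, {t | (t.1.2 i k : Matrix n n ℂ).trace = (D i k).trace}) ∩
        ⋂ i, ⋂ k, {t | c i k ≤
          ((t.1.1 : Matrix n n ℂ) * (t.1.2 i k : Matrix n n ℂ)).trace.re})) := by
      ext t
      simp only [Z, Set.mem_inter_iff, Set.mem_iInter, Set.mem_ofPred_eq]
    rw [hZi]
    refine IsClosed.inter ?_ (IsClosed.inter ?_ (IsClosed.inter ?_ ?_))
    · exact isClosed_eq (Continuous.matrix_trace (by fun_prop)) continuous_const
    · refine isClosed_iInter fun i => isClosed_iInter fun k => isClosed_eq ?_ ?_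
      · exact (hQc i k).matrix_mul (Continuous.matrix_mul (by fun_prop) continuous_const)
      · exact Continuous.matrix_mul (by fun_prop) continuous_const
    · refine isClosed_iInter fun i => isClosed_iInter fun k => isClosed_eq ?_ continuous_const
      exact (hQc i k).matrix_trace
    · refine isClosed_iInter fun i => isClosed_iInter fun k => isClosed_le continuous_const ?_
      refine Complex.continuous_re.comp (Continuous.matrix_trace ?_)
      exact Continuous.matrix_mul (by fun_prop) (hQc i k)
  have hZ' : IsClosed (Prod.snd '' Z) := isClosedMap_snd_of_compactSpace _ hZ
  have hdense := denseRange_flagProduct P U w (flagProduct_range_mem_nhds P hP hPt U hU w hind)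
  let O : Set (ι → Matrix n n ℂ) := {g | ∀ i, (g i).det ≠ 0}
  have hO : IsOpen O := by
    simp only [O, Set.ofPred_forall]
    exact isOpen_iInter_of_finite fun i => isOpen_ne_fun
      (Continuous.matrix_det (continuous_apply i)) continuous_const
  have hVO : V ∈ O := fun i h0 => by
    have := congrArg Matrix.det (hV i)
    rw [det_mul, h0, mul_zero, det_one] at this
    exact zero_ne_one this
  have hsub : O ∩ Set.range (flagProduct P U w) ⊆ Prod.snd '' Z := by
    rintro _ ⟨hx, x, rfl⟩
    obtain ⟨p, Q, hp, hQ, h1, h2, h3, h4⟩ := flagProduct_exists_projections P hP U S hS w x hx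
    exact ⟨((⟨p, hp⟩, fun i k => ⟨Q i k, hQ i k⟩), flagProduct P U w x), ⟨h1, h2, h3, h4⟩, rfl⟩
  obtain ⟨⟨⟨⟨p, hp⟩, Q⟩, V'⟩, ⟨h1, h2, h3, h4⟩, rfl⟩ : V ∈ Prod.snd '' Z :=
    hZ'.closure_subset_iff.mpr hsub (hdense.open_subset_closure_inter hO hVO)
  simp only at h1 h2 h3 h4 hV
  refine ⟨p, fun i => ?_⟩
  have hV2 : V' i * (V' i)ᴴ = 1 := mul_eq_one_comm.mp (hV i)
  have hQ : ∀ k, (Q i k : Matrix n n ℂ) = V' i * D i k * (V' i)ᴴ := by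
    intro k
    have hDs : IsStarProjection (D i k) := by
      simp only [D, upperProj_eq]; exact isStarProjection_coordProj _
    refine (Q i k).2.eq_of_mul_eq_of_trace_eq ⟨?_, ?_⟩ ?_ ?_
    · rw [IsIdempotentElem]
      calc V' i * D i k * (V' i)ᴴ * (V' i * D i k * (V' i)ᴴ)
          = V' i * D i k * ((V' i)ᴴ * V' i) * D i k * (V' i)ᴴ := by simp only [mul_assoc]
        _ = V' i * (D i k * D i k) * (V' i)ᴴ := by rw [hV, mul_one]; simp only [mul_assoc]
        _ = _ := by rw [hDs.isIdempotentElem.eq]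
    · rw [IsSelfAdjoint, star_eq_conjTranspose, conjTranspose_mul, conjTranspose_mul,
        conjTranspose_conjTranspose, ← star_eq_conjTranspose (D i k), hDs.isSelfAdjoint.star_eq,
        mul_assoc]
    · rw [← mul_assoc, h2]
    · rw [h3, mul_assoc, trace_mul_comm, mul_assoc, hV, mul_one]
  let x : n → ℝ := fun l => ((V' i)ᴴ * p * V' i) l l |>.re
  have hx : ∀ d : n → ℝ, (p * (V' i * diagonal (fun k => (d k : ℂ)) * (V' i)ᴴ)).trace.re
      = ∑ l, d l * x l := by
    intro d
    rw [← mul_assoc, trace_mul_comm, ← mul_assoc, ← mul_assoc, trace, Complex.re_sum]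
    refine Finset.sum_congr rfl fun l _ => ?_
    rw [diag_apply, mul_diagonal, Complex.re_mul_ofReal, mul_comm]
  have hSr : P.rank = (S i).card := by
    have hUi : IsUnit (U i).det := by
      have := congrArg Matrix.det (hU i)
      rw [det_mul, det_one] at this
      exact IsUnit.of_mul_eq_one _ this
    rw [← Matrix.rank_mul_eq_left_of_isUnit_det _ P hUi, hS,
      Matrix.rank_mul_eq_right_of_isUnit_det _ _ hUi, rank_coordProj]
  have hxsum : ∑ l, x l = (S i).card := by
    have := hx 1
    simp only [Pi.one_apply, Complex.ofReal_one, diagonal_one, mul_one, hV2, one_mul] at this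
    rw [← this, h1, hSr]
    simp
  rw [hx]
  let v : n → ℝ := fun l => x l - if l ∈ S i then 1 else 0
  have hv0 : ∑ l, v l = 0 := by
    simp [v, Finset.sum_sub_distrib, hxsum]
  have hkey := Finset.sum_sub_mul_nonneg_of_upper_sums_nonneg (w i) v Finset.univ (fun k _ => ?_)
  · rcases (Finset.univ : Finset n).eq_empty_or_nonempty with he | hne
    · have : S i = ∅ := Finset.subset_empty.mp (he ▸ Finset.subset_univ _)
      simp [he, this]
    · obtain ⟨k, -, hk⟩ := Finset.univ.exists_min_image (w i) hne
      have := hkey (w i k) fun j hj => hk j hj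
      simp only [sub_mul, Finset.sum_sub_distrib, ← Finset.mul_sum, hv0, mul_zero, sub_zero] at this
      simp only [v, mul_sub, Finset.sum_sub_distrib, mul_ite, mul_one, mul_zero,
        Finset.sum_ite_mem, Finset.univ_inter] at this
      linarith
  · have := h4 i k
    rw [hQ] at this
    have hD : D i k = diagonal fun l => (((if w i k ≤ w i l then 1 else 0 : ℝ)) : ℂ) := by
      simp only [D, upperProj]
      congr 1
      ext l
      split_ifs <;> simp
    rw [hD, hx] at this
    simp only [v, Finset.sum_sub_distrib]
    rw [Finset.sum_filter, sub_nonneg]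
    simp only [ite_mul, one_mul, zero_mul] at this
    refine le_trans (le_of_eq ?_) this
    simp [c, Finset.inter_comm]

end FlagProjections

section SymmetricMatrices

variable {n : Type*} [Fintype n] [DecidableEq n]

theorem Matrix.IsSymm.exists_simultaneous_diagonalization {a d : Matrix n n ℝ} (ha : a.IsSymm)
    (hd : d.IsSymm) (h : a * d = d * a) :
    ∃ (U : Matrix n n ℝ) (v w : n → ℝ), Uᵀ * U = 1 ∧ a * U = U * diagonal v ∧
      d * U = U * diagonal w := by
  have hsym : ∀ {b : Matrix n n ℝ}, b.IsSymm → (toEuclideanLin b).IsSymmetric := fun {b} hb =>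
    Matrix.isSymmetric_toEuclideanLin_iff.mpr (by
      rw [Matrix.IsHermitian, conjTranspose_eq_transpose_of_trivial]; exact hb)
  have hcomm : Commute (toEuclideanLin a) (toEuclideanLin d) := by
    rw [commute_iff_eq, Module.End.mul_eq_comp, Module.End.mul_eq_comp, ← Matrix.toLpLin_mul_same,
      h, Matrix.toLpLin_mul_same]
  have hint := (hsym ha).directSum_isInternal_of_commute (hsym hd) hcomm
  have hort := (hsym ha).orthogonalFamily_eigenspace_inf_eigenspace (hsym hd)
  have hfin := WellFoundedGT.finite_ne_bot_of_iSupIndep hint.submodule_iSupIndep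
  have hint' := DirectSum.isInternal_ne_bot_iff.mpr hint
  have : Fintype {i : ℝ × ℝ // Module.End.eigenspace (toEuclideanLin a) i.2 ⊓
      Module.End.eigenspace (toEuclideanLin d) i.1 ≠ ⊥} := hfin.fintype
  have hort' := hort.comp (Subtype.val_injective : Function.Injective (Subtype.val :
    {i : ℝ × ℝ // Module.End.eigenspace (toEuclideanLin a) i.2 ⊓
      Module.End.eigenspace (toEuclideanLin d) i.1 ≠ ⊥} → ℝ × ℝ))
  obtain ⟨e⟩ : Nonempty (n ≃ Fin (Fintype.card n)) := ⟨Fintype.equivFin n⟩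
  have hcard : Module.finrank ℝ (EuclideanSpace ℝ n) = Fintype.card n := finrank_euclideanSpace
  obtain ⟨b, idx, hb⟩ : ∃ (b : OrthonormalBasis (Fin (Fintype.card n)) ℝ (EuclideanSpace ℝ n))
      (idx : n → ℝ × ℝ), ∀ k, b (e k) ∈ Module.End.eigenspace (toEuclideanLin a) (idx k).2 ⊓
      Module.End.eigenspace (toEuclideanLin d) (idx k).1 :=
    ⟨hint'.subordinateOrthonormalBasis hcard hort',
      fun k => (hint'.subordinateOrthonormalBasisIndex hcard (e k) hort').1, fun k =>
      hint'.subordinateOrthonormalBasis_subordinate hcard (e k) hort'⟩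
  have hmul : ∀ (c : Matrix n n ℝ) (v : n → ℝ),
      (∀ k, toEuclideanLin c (b (e k)) = v k • b (e k)) →
      c * (of fun i k => b (e k) i) = (of fun i k => b (e k) i) * diagonal v := by
    intro c v hv
    ext i k
    rw [mul_diagonal, of_apply, mul_comm]
    exact congrFun (congrArg WithLp.ofLp (hv k)) i
  refine ⟨of fun i k => b (e k) i, fun k => (idx k).2, fun k => (idx k).1, ?_,
    hmul _ _ fun k => Module.End.mem_eigenspace_iff.mp (hb k).1,
    hmul _ _ fun k => Module.End.mem_eigenspace_iff.mp (hb k).2⟩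
  ext k l
  have := orthonormal_iff_ite.mp b.orthonormal (e k) (e l)
  rw [PiLp.inner_apply] at this
  simp only [Matrix.mul_apply, transpose_apply, of_apply, Matrix.one_apply]
  simpa [mul_comm] using this

theorem Matrix.IsSymm.exists_conjugate_of_charpoly_eq {a b : Matrix n n ℝ} (ha : a.IsSymm)
    (hb : b.IsSymm) (h : a.charpoly = b.charpoly) :
    ∃ W : Matrix n n ℝ, Wᵀ * W = 1 ∧ a = W * b * Wᵀ := by
  have ha' : a.IsHermitian := by
    rw [Matrix.IsHermitian, conjTranspose_eq_transpose_of_trivial]; exact ha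
  have hb' : b.IsHermitian := by
    rw [Matrix.IsHermitian, conjTranspose_eq_transpose_of_trivial]; exact hb
  have he := (IsHermitian.eigenvalues_eq_eigenvalues_iff ha' hb').mpr h
  have h1 := ha'.spectral_theorem
  have h2 := hb'.spectral_theorem
  have hu : ∀ u : unitaryGroup n ℝ, (u : Matrix n n ℝ)ᵀ * u = 1 := fun u => by
    have := Matrix.mem_unitaryGroup_iff'.mp u.2
    rwa [star_eq_conjTranspose, conjTranspose_eq_transpose_of_trivial] at this
  rw [← he] at h2
  simp only [Unitary.conjStarAlgAut_apply, star_eq_conjTranspose,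
    conjTranspose_eq_transpose_of_trivial] at h1 h2
  have hX := hu ha'.eigenvectorUnitary
  have hY := hu hb'.eigenvectorUnitary
  generalize (ha'.eigenvectorUnitary : Matrix n n ℝ) = X at h1 hX
  generalize (hb'.eigenvectorUnitary : Matrix n n ℝ) = Y at h2 hY
  generalize (diagonal _ : Matrix n n ℝ) = E at h1 h2
  refine ⟨X * Yᵀ, ?_, ?_⟩
  · rw [transpose_mul, transpose_transpose, mul_assoc, ← mul_assoc Xᵀ, hX, one_mul,
      mul_eq_one_comm.mp hY]
  · rw [h1, h2, transpose_mul, transpose_transpose]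
    calc X * E * Xᵀ = X * (Yᵀ * Y) * E * (Yᵀ * Y) * Xᵀ := by simp [hY]
      _ = _ := by simp only [mul_assoc]

end SymmetricMatrices

section SecondDerivativeTest

theorem eq_zero_and_nonneg_of_forall_le {g g₁ : ℝ → ℝ} {c : ℝ} (hg : ∀ t, HasDerivAt g (g₁ t) t)
    (hg₁ : HasDerivAt g₁ c 0) (hmin : ∀ t, g 0 ≤ g t) : g₁ 0 = 0 ∧ 0 ≤ c := by
  have hloc : IsLocalMin g 0 := Filter.Eventually.of_forall hmin
  have h0 : g₁ 0 = 0 := hloc.hasDerivAt_eq_zero (hg 0)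
  have hder : deriv g = g₁ := funext fun t => (hg t).deriv
  refine ⟨h0, not_lt.mp fun hc => ?_⟩
  have hmax : IsLocalMax g 0 := isLocalMax_of_deriv_deriv_neg (by rw [hder, hg₁.deriv]; exact hc)
    (by rw [hder, h0]) (hg 0).continuousAt
  have heq : g =ᶠ[nhds 0] fun _ => g 0 := hmax.mono fun t ht => le_antisymm ht (hmin t)
  have h2 : g₁ =ᶠ[nhds 0] fun _ => 0 := by
    have := heq.deriv
    rwa [hder, deriv_const'] at this
  have := (hg₁.congr_of_eventuallyEq h2.symm).unique (hasDerivAt_const (0 : ℝ) (0 : ℝ))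
  exact hc.ne this

end SecondDerivativeTest

section ConjugationCurves

variable {n : Type*} [Fintype n] [DecidableEq n]

open NormedSpace in
/-- The curve `t ↦ exp (tX) a exp (-tX)`. -/
noncomputable def Matrix.expConj (X a : Matrix n n ℝ) (t : ℝ) : Matrix n n ℝ :=
  exp (t • X) * a * exp (-(t • X))

theorem Matrix.expConj_zero (X a : Matrix n n ℝ) : expConj X a 0 = a := by
  simp [expConj]

open scoped Matrix.Norms.L2Operator in
theorem Matrix.hasDerivAt_expConj (X a : Matrix n n ℝ) (t : ℝ) :
    HasDerivAt (expConj X a) (expConj X (X * a - a * X) t) t := by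
  have h1 := hasDerivAt_exp_smul_const X t
  have h2 := hasDerivAt_exp_smul_const' (-X) t
  have h3 := (h1.mul_const a).mul h2
  simp only [smul_neg] at h3
  refine h3.congr_deriv ?_
  simp only [expConj]
  noncomm_ring

theorem Matrix.expConj_eq (X a : Matrix n n ℝ) (hX : Xᵀ = -X) (t : ℝ) :
    ∃ W : Matrix n n ℝ, Wᵀ * W = 1 ∧ expConj X a t = W * a * Wᵀ ∧
      ∀ J, J * X = X * J → J * W = W * J := by
  have ht : (NormedSpace.exp (t • X))ᵀ = NormedSpace.exp (-(t • X)) := by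
    rw [← Matrix.exp_transpose, transpose_smul, hX, smul_neg]
  refine ⟨NormedSpace.exp (t • X), ?_, ?_, fun J hJ => ?_⟩
  · rw [ht, ← Matrix.exp_add_of_commute _ _ (Commute.refl (t • X)).neg_left, neg_add_cancel,
      NormedSpace.exp_zero]
  · rw [ht, expConj]
  · exact (Commute.smul_right (show Commute J X from hJ) t).exp_right

open scoped Matrix.Norms.L2Operator in
theorem hasDerivAt_trace_mul_self {G : ℝ → Matrix n n ℝ} {G' : Matrix n n ℝ} {t : ℝ}
    (h : HasDerivAt G G' t) : HasDerivAt (fun s => (G s * G s).trace) (2 * (G t * G').trace) t := by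
  have := (LinearMap.toContinuousLinearMap (traceLinearMap n ℝ ℝ)).hasFDerivAt.comp_hasDerivAt t
    (h.mul h)
  refine this.congr_deriv ?_
  simp [trace_mul_comm G', two_mul]

open scoped Matrix.Norms.L2Operator in
theorem variation_of_forall_le {a C J X Y : Matrix n n ℝ} (hJ : Jᵀ * J = 1) (hX : Xᵀ = -X)
    (hY : Yᵀ = -Y) (hJY : J * Y = Y * J)
    (hmin : ∀ W : Matrix n n ℝ, Wᵀ * W = 1 → ((a + Jᵀ * a * J - C) * (a + Jᵀ * a * J - C)).trace ≤
      ((W * a * Wᵀ + Jᵀ * (W * a * Wᵀ) * J - C) *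
        (W * a * Wᵀ + Jᵀ * (W * a * Wᵀ) * J - C)).trace)
    {D a₁ C₁ a₂ C₂ G₁ G₂ : Matrix n n ℝ} (hD : a + Jᵀ * a * J - C = D)
    (ha₁ : X * a - a * X = a₁) (hC₁ : Y * C - C * Y = C₁)
    (ha₂ : X * a₁ - a₁ * X = a₂) (hC₂ : Y * C₁ - C₁ * Y = C₂)
    (hG₁ : a₁ + Jᵀ * a₁ * J - C₁ = G₁) (hG₂ : a₂ + Jᵀ * a₂ * J - C₂ = G₂) :
    (D * G₁).trace = 0 ∧ 0 ≤ (G₁ * G₁).trace + (D * G₂).trace := by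
  let G : Matrix n n ℝ → Matrix n n ℝ → ℝ → Matrix n n ℝ := fun a C t =>
    expConj X a t + Jᵀ * expConj X a t * J - expConj Y C t
  have hG : ∀ a C t, HasDerivAt (G a C) (G (X * a - a * X) (Y * C - C * Y) t) t := fun a C t =>
    (((hasDerivAt_expConj X a t)).add (((hasDerivAt_expConj X a t).const_mul Jᵀ).mul_const J)).sub
      (hasDerivAt_expConj Y C t)
  have hG0 : ∀ a C, G a C 0 = a + Jᵀ * a * J - C := fun a C => by
    simp only [G, expConj_zero]
  have hg := fun t => hasDerivAt_trace_mul_self (hG a C t)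
  have hg₁ : HasDerivAt (fun t => 2 * (G a C t * G a₁ C₁ t).trace)
      (2 * ((G₁ * G₁).trace + (D * G₂).trace)) 0 := by
    have h1 := hG a C 0
    have h2 := hG a₁ C₁ 0
    rw [ha₁, hC₁] at h1
    rw [ha₂, hC₂] at h2
    have := ((LinearMap.toContinuousLinearMap (traceLinearMap n ℝ ℝ)).hasFDerivAt.comp_hasDerivAt
      (0 : ℝ) (h1.mul h2)).const_mul 2
    refine this.congr_deriv ?_
    simp [hG0, hD, hG₁, hG₂]
  have hle : ∀ t, (G a C 0 * G a C 0).trace ≤ (G a C t * G a C t).trace := by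
    intro t
    obtain ⟨W, hW, hWa, -⟩ := expConj_eq X a hX t
    obtain ⟨V, hV, hVC, hVJ⟩ := expConj_eq Y C hY t
    have hV' : V * Vᵀ = 1 := mul_eq_one_comm.mp hV
    have hJV := hVJ J hJY
    have hJ' : J * Jᵀ = 1 := mul_eq_one_comm.mp hJ
    have hJV' : Jᵀ * V = V * Jᵀ := by
      calc Jᵀ * V = Jᵀ * (V * J) * Jᵀ := by rw [mul_assoc, mul_assoc V, hJ', mul_one]
        _ = V * Jᵀ := by rw [← hJV, ← mul_assoc, hJ, one_mul]
    have hconj : ∀ M : Matrix n n ℝ, (V * M * Vᵀ * (V * M * Vᵀ)).trace = (M * M).trace := by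
      intro M
      have : V * M * Vᵀ * (V * M * Vᵀ) = V * (M * (Vᵀ * V) * M * Vᵀ) := by simp only [mul_assoc]
      rw [this, trace_mul_comm, hV, mul_one, mul_assoc, hV, mul_one]
    rw [hG0]
    refine (hmin (Vᵀ * W) ?_).trans_eq ?_
    · rw [transpose_mul, transpose_transpose, mul_assoc, ← mul_assoc V, hV', one_mul, hW]
    · have : G a C t =
          V * (Vᵀ * W * a * (Vᵀ * W)ᵀ + Jᵀ * (Vᵀ * W * a * (Vᵀ * W)ᵀ) * J - C) * Vᵀ := by
        have hJV'' : J * Vᵀ = Vᵀ * J := by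
          have := congrArg transpose hJV'
          simpa [transpose_mul] using this.symm
        simp only [G, hWa, hVC, transpose_mul, transpose_transpose, mul_sub, sub_mul, mul_add,
          add_mul]
        congr 1
        congr 1
        · calc W * a * Wᵀ = (V * Vᵀ) * W * a * (Wᵀ * (V * Vᵀ)) := by simp [hV', mul_assoc]
            _ = _ := by simp only [mul_assoc]
        · calc Jᵀ * (W * a * Wᵀ) * J = Jᵀ * ((V * Vᵀ) * W * a * (Wᵀ * (V * Vᵀ))) * J := by
                simp [hV']
            _ = (Jᵀ * V) * Vᵀ * W * a * Wᵀ * V * (Vᵀ * J) := by simp only [mul_assoc]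
            _ = _ := by rw [hJV', ← hJV'']; simp only [mul_assoc]
      rw [this, hconj]
  have := eq_zero_and_nonneg_of_forall_le (g₁ := fun t => 2 * (G a C t * G a₁ C₁ t).trace)
    (by rw [ha₁, hC₁] at hg; exact hg) hg₁ hle
  simp only [hG0, hD, hG₁] at this
  exact ⟨by linarith [this.1], by linarith [this.2]⟩

end ConjugationCurves

section Masks

variable {n : Type*} [Fintype n] [DecidableEq n]

/-- The matrices whose entries in the frame `U` are supported on the relation `r`. -/
def Matrix.maskSubmodule (U : Matrix n n ℝ) (r : n → n → Prop) :
    Submodule ℝ (Matrix n n ℝ) where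
  carrier := {Z | ∀ k l, ¬ r k l → (Uᵀ * Z * U) k l = 0}
  add_mem' := fun {x y} hx hy k l h => by
    simp [mul_add, add_mul, hx k l h, hy k l h]
  zero_mem' := by simp
  smul_mem' := fun c x hx k l h => by simp [hx k l h]

open Classical in
/-- The projection onto `maskSubmodule U r` that deletes the entries outside `r`. -/
noncomputable def Matrix.maskProj (U : Matrix n n ℝ) (r : n → n → Prop) :
    Matrix n n ℝ →ₗ[ℝ] Matrix n n ℝ where
  toFun Z := U * (of fun k l => if r k l then (Uᵀ * Z * U) k l else 0) * Uᵀ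
  map_add' x y := by
    rw [← add_mul, ← mul_add]
    congr 2
    ext k l
    by_cases h : r k l <;> simp [h, mul_add, add_mul]
  map_smul' c x := by
    rw [RingHom.id_apply, ← smul_mul_assoc, ← mul_smul_comm]
    congr 2
    ext k l
    by_cases h : r k l <;> simp [h]

variable {U : Matrix n n ℝ} {r s : n → n → Prop}

theorem Matrix.maskSubmodule_mono (h : ∀ k l, r k l → s k l) :
    maskSubmodule U r ≤ maskSubmodule U s :=
  fun _ hZ k l hs => hZ k l fun hr => hs (h k l hr)

theorem Matrix.mem_maskSubmodule_and {Z : Matrix n n ℝ} (hr : Z ∈ maskSubmodule U r)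
    (hs : Z ∈ maskSubmodule U s) : Z ∈ maskSubmodule U fun k l => r k l ∧ s k l := by
  intro k l h
  by_cases hk : r k l
  · exact hs k l fun h' => h ⟨hk, h'⟩
  · exact hr k l hk

theorem Matrix.transpose_conj_conj (hU : Uᵀ * U = 1) (Z : Matrix n n ℝ) :
    Uᵀ * (U * Z * Uᵀ) * U = Z := by
  calc Uᵀ * (U * Z * Uᵀ) * U = (Uᵀ * U) * Z * (Uᵀ * U) := by simp only [mul_assoc]
    _ = Z := by rw [hU, one_mul, mul_one]

theorem Matrix.conj_transpose_conj (hU : Uᵀ * U = 1) (Z : Matrix n n ℝ) :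
    U * (Uᵀ * Z * U) * Uᵀ = Z := by
  have hU' : U * Uᵀ = 1 := mul_eq_one_comm.mp hU
  calc U * (Uᵀ * Z * U) * Uᵀ = (U * Uᵀ) * Z * (U * Uᵀ) := by simp only [mul_assoc]
    _ = Z := by rw [hU', one_mul, mul_one]

theorem Matrix.eq_of_transpose_conj_eq (hU : Uᵀ * U = 1) {Z W : Matrix n n ℝ}
    (h : ∀ k l, (Uᵀ * Z * U) k l = (Uᵀ * W * U) k l) : Z = W := by
  rw [← conj_transpose_conj hU Z, ← conj_transpose_conj hU W, Matrix.ext h]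

open Classical in
theorem Matrix.transpose_conj_maskProj (hU : Uᵀ * U = 1) (Z : Matrix n n ℝ) (k l : n) :
    (Uᵀ * maskProj U r Z * U) k l = if r k l then (Uᵀ * Z * U) k l else 0 := by
  exact congrFun (congrFun (transpose_conj_conj hU _) k) l

theorem Matrix.maskProj_mem (hU : Uᵀ * U = 1) (Z : Matrix n n ℝ) :
    maskProj U r Z ∈ maskSubmodule U r := by
  intro k l h
  rw [transpose_conj_maskProj hU, if_neg h]

theorem Matrix.sub_maskProj_mem (hU : Uᵀ * U = 1) (Z : Matrix n n ℝ) :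
    Z - maskProj U r Z ∈ maskSubmodule U fun k l => ¬ r k l := by
  intro k l h
  rw [mul_sub, sub_mul, sub_apply, transpose_conj_maskProj hU, if_pos (not_not.mp h), sub_self]

theorem Matrix.maskProj_eq_self (hU : Uᵀ * U = 1) {Z : Matrix n n ℝ}
    (hZ : Z ∈ maskSubmodule U r) : maskProj U r Z = Z := by
  refine eq_of_transpose_conj_eq hU fun k l => ?_
  rw [transpose_conj_maskProj hU]
  split_ifs with h
  · rfl
  · exact (hZ k l h).symm

theorem Matrix.maskProj_eq_zero (hU : Uᵀ * U = 1) {Z : Matrix n n ℝ}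
    (hZ : Z ∈ maskSubmodule U fun k l => ¬ r k l) : maskProj U r Z = 0 := by
  refine eq_of_transpose_conj_eq hU fun k l => ?_
  rw [transpose_conj_maskProj hU]
  split_ifs with h
  · simpa using hZ k l (not_not.mpr h)
  · simp

theorem Matrix.mem_maskSubmodule_of_maskProj_eq_zero (hU : Uᵀ * U = 1) {Z : Matrix n n ℝ}
    (hZ : maskProj U r Z = 0) : Z ∈ maskSubmodule U fun k l => ¬ r k l := by
  have := sub_maskProj_mem (r := r) hU Z
  rwa [hZ, sub_zero] at this

theorem Matrix.trace_transpose_mul_eq_sum (hU : Uᵀ * U = 1) (x y : Matrix n n ℝ) :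
    (xᵀ * y).trace = ∑ k, ∑ l, (Uᵀ * x * U) k l * (Uᵀ * y * U) k l := by
  have hU' : U * Uᵀ = 1 := mul_eq_one_comm.mp hU
  have h : (xᵀ * y).trace = ((Uᵀ * x * U)ᵀ * (Uᵀ * y * U)).trace := by
    have : (Uᵀ * x * U)ᵀ * (Uᵀ * y * U) = Uᵀ * (xᵀ * (U * Uᵀ) * y * U) := by
      simp only [transpose_mul, transpose_transpose, mul_assoc]
    rw [this, hU', trace_mul_comm Uᵀ, mul_one, mul_assoc _ U, hU', mul_one]
  rw [h, trace, Finset.sum_comm]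
  simp only [diag_apply, mul_apply, transpose_apply]

theorem Matrix.trace_transpose_mul_eq_zero_of_disjoint (hU : Uᵀ * U = 1) {x y : Matrix n n ℝ}
    (hx : x ∈ maskSubmodule U r) (hy : y ∈ maskSubmodule U s) (h : ∀ k l, r k l → ¬ s k l) :
    (xᵀ * y).trace = 0 := by
  rw [trace_transpose_mul_eq_sum hU]
  refine Finset.sum_eq_zero fun k _ => Finset.sum_eq_zero fun l _ => ?_
  by_cases hr : r k l
  · rw [hy k l (h k l hr), mul_zero]
  · rw [hx k l hr, zero_mul]

theorem Matrix.transpose_conj_commutator {a : Matrix n n ℝ} {v : n → ℝ} (hU : Uᵀ * U = 1)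
    (ha : a * U = U * diagonal v) (Z : Matrix n n ℝ) (k l : n) :
    (Uᵀ * (a * Z - Z * a) * U) k l = (v k - v l) * (Uᵀ * Z * U) k l := by
  have hU' : U * Uᵀ = 1 := mul_eq_one_comm.mp hU
  have ha' : Uᵀ * a = diagonal v * Uᵀ := by
    calc Uᵀ * a = Uᵀ * (a * U) * Uᵀ := by rw [mul_assoc, mul_assoc, hU', mul_one]
      _ = _ := by rw [ha, ← mul_assoc, hU, one_mul]
  have : Uᵀ * (a * Z - Z * a) * U =
      diagonal v * (Uᵀ * Z * U) - Uᵀ * Z * U * diagonal v := by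
    calc _ = (Uᵀ * a) * Z * U - Uᵀ * Z * (a * U) := by noncomm_ring
      _ = _ := by rw [ha, ha']; simp only [mul_assoc]
  rw [this, sub_apply, diagonal_mul, mul_diagonal]
  ring

theorem Matrix.exists_commutator_eq {a u : Matrix n n ℝ} {v : n → ℝ} (hU : Uᵀ * U = 1)
    (ha : a * U = U * diagonal v) (hu : u ∈ maskSubmodule U r) (hr : ∀ k l, r k l → v k ≠ v l) :
    ∃ x ∈ maskSubmodule U r, a * x - x * a = u := by
  refine ⟨U * (of fun k l => (Uᵀ * u * U) k l / (v k - v l)) * Uᵀ, fun k l h => ?_,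
    eq_of_transpose_conj_eq hU fun k l => ?_⟩
  · rw [transpose_conj_conj hU, of_apply, hu k l h, zero_div]
  · rw [transpose_conj_commutator hU ha, transpose_conj_conj hU, of_apply]
    by_cases h : r k l
    · exact mul_div_cancel₀ _ (sub_ne_zero.mpr (hr k l h))
    · rw [hu k l h, zero_div, mul_zero]

end Masks

section AdaptedFrames

variable {n : Type*} [Fintype n] [DecidableEq n]

/-- `U` is an orthogonal frame of common eigenvectors of `a`, `D` and the projection `P`, with
eigenvalues `v`, `w` and the indicator of `S`, and `w` is larger on `S` than outside `S`. -/
structure Matrix.IsAdaptedFrame (P D a U : Matrix n n ℝ) (S : Finset n) (v w : n → ℝ) : Prop where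
  orth : Uᵀ * U = 1
  mul_eq : a * U = U * diagonal v
  defect_mul_eq : D * U = U * diagonal w
  proj_mul_eq : P * U = U * diagonal fun k => if k ∈ S then 1 else 0
  lt : ∀ k, k ∉ S → ∀ l, l ∈ S → w k < w l

variable {P D a U : Matrix n n ℝ} {S : Finset n} {v w : n → ℝ}

namespace Matrix.IsAdaptedFrame

theorem mem_offBlock (h : IsAdaptedFrame P D a U S v w) {Z : Matrix n n ℝ} :
    Z ∈ maskSubmodule U (fun k l => k ∉ S ∧ l ∈ S) ↔ (1 - P) * Z * P = Z := by
  have hU' : U * Uᵀ = 1 := mul_eq_one_comm.mp h.orth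
  have hP : Uᵀ * P = diagonal (fun k => if k ∈ S then 1 else 0) * Uᵀ := by
    calc Uᵀ * P = Uᵀ * (P * U) * Uᵀ := by rw [mul_assoc, mul_assoc, hU', mul_one]
      _ = _ := by rw [h.proj_mul_eq, ← mul_assoc, h.orth, one_mul]
  have hc : Uᵀ * ((1 - P) * Z * P) * U = (Uᵀ * Z * U) * (diagonal fun k => if k ∈ S then 1 else 0) -
      (diagonal fun k => if k ∈ S then 1 else 0) *
        ((Uᵀ * Z * U) * (diagonal fun k => if k ∈ S then 1 else 0)) := by
    calc _ = Uᵀ * Z * (P * U) - (Uᵀ * P) * Z * (P * U) := by noncomm_ring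
      _ = _ := by rw [h.proj_mul_eq, hP]; simp only [mul_assoc]
  constructor
  · intro hZ
    refine eq_of_transpose_conj_eq h.orth fun k l => ?_
    rw [hc, sub_apply, diagonal_mul, mul_diagonal]
    by_cases hk : k ∈ S
    · rw [hZ k l fun h' => h'.1 hk]; simp
    · by_cases hl : l ∈ S
      · simp [hk, hl]
      · rw [hZ k l fun h' => hl h'.2]; simp
  · intro hZ k l hkl
    rw [← hZ, hc, sub_apply, diagonal_mul, mul_diagonal]
    by_cases hk : k ∈ S
    · simp [hk]
    · have hl : l ∉ S := fun hl => hkl ⟨hk, hl⟩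
      simp [hl]

theorem commute_proj (h : IsAdaptedFrame P D a U S v w) : D * P = P * D := by
  have hU' : U * Uᵀ = 1 := mul_eq_one_comm.mp h.orth
  have : (D * P) * U = (P * D) * U := by
    rw [mul_assoc, h.proj_mul_eq, ← mul_assoc, h.defect_mul_eq, mul_assoc, mul_assoc,
      h.defect_mul_eq, ← mul_assoc P, h.proj_mul_eq, mul_assoc, diagonal_mul_diagonal,
      diagonal_mul_diagonal]
    simp only [mul_comm]
  calc D * P = D * P * U * Uᵀ := by rw [mul_assoc _ U, hU', mul_one]
    _ = P * D := by rw [this, mul_assoc _ U, hU', mul_one]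

theorem proj_mul_self (h : IsAdaptedFrame P D a U S v w) : P * P = P := by
  have hU' : U * Uᵀ = 1 := mul_eq_one_comm.mp h.orth
  have : (P * P) * U = P * U := by
    rw [mul_assoc, h.proj_mul_eq, ← mul_assoc, h.proj_mul_eq, mul_assoc, diagonal_mul_diagonal]
    congr 2
    ext k
    by_cases hk : k ∈ S <;> simp [hk]
  calc P * P = P * P * U * Uᵀ := by rw [mul_assoc _ U, hU', mul_one]
    _ = P := by rw [this, mul_assoc _ U, hU', mul_one]

theorem trace_commutator (h : IsAdaptedFrame P D a U S v w) (x : Matrix n n ℝ) :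
    ((D * x - x * D)ᵀ * (a * x - x * a)).trace =
      ∑ k, ∑ l, (w k - w l) * (v k - v l) * (Uᵀ * x * U) k l ^ 2 := by
  rw [trace_transpose_mul_eq_sum h.orth]
  refine Finset.sum_congr rfl fun k _ => Finset.sum_congr rfl fun l _ => ?_
  rw [transpose_conj_commutator h.orth h.defect_mul_eq, transpose_conj_commutator h.orth h.mul_eq]
  ring

theorem trace_mul_commutator (h : IsAdaptedFrame P D a U S v w) (x : Matrix n n ℝ) :
    (xᵀ * (a * x - x * a)).trace = ∑ k, ∑ l, (v k - v l) * (Uᵀ * x * U) k l ^ 2 := by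
  rw [trace_transpose_mul_eq_sum h.orth]
  refine Finset.sum_congr rfl fun k _ => Finset.sum_congr rfl fun l _ => ?_
  rw [transpose_conj_commutator h.orth h.mul_eq]
  ring

theorem trace_mul_defect_commutator (h : IsAdaptedFrame P D a U S v w) (x : Matrix n n ℝ) :
    (xᵀ * (D * x - x * D)).trace = ∑ k, ∑ l, (w k - w l) * (Uᵀ * x * U) k l ^ 2 := by
  rw [trace_transpose_mul_eq_sum h.orth]
  refine Finset.sum_congr rfl fun k _ => Finset.sum_congr rfl fun l _ => ?_
  rw [transpose_conj_commutator h.orth h.defect_mul_eq]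
  ring

end Matrix.IsAdaptedFrame

theorem Matrix.eq_zero_of_sum_mul_sq_nonpos {U x : Matrix n n ℝ} {c : n → n → ℝ} (hU : Uᵀ * U = 1)
    (hc : ∀ k l, (Uᵀ * x * U) k l ≠ 0 → 0 < c k l)
    (h : ∑ k, ∑ l, c k l * (Uᵀ * x * U) k l ^ 2 ≤ 0) : x = 0 := by
  have hnn : ∀ k l, 0 ≤ c k l * (Uᵀ * x * U) k l ^ 2 := fun k l => by
    by_cases h0 : (Uᵀ * x * U) k l = 0
    · simp [h0]
    · exact mul_nonneg (hc k l h0).le (sq_nonneg _)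
  have h0 := le_antisymm h (Finset.sum_nonneg fun k _ => Finset.sum_nonneg fun l _ => hnn k l)
  refine eq_of_transpose_conj_eq hU fun k l => ?_
  have h1 := (Finset.sum_eq_zero_iff_of_nonneg fun k _ =>
    Finset.sum_nonneg fun l _ => hnn k l).mp h0 k (Finset.mem_univ k)
  have h2 := (Finset.sum_eq_zero_iff_of_nonneg fun l _ => hnn k l).mp h1 l (Finset.mem_univ l)
  by_contra hne
  have hne' : (Uᵀ * x * U) k l ≠ 0 := by simpa using hne
  exact (mul_pos (hc k l hne') (by positivity)).ne' h2

theorem Matrix.trace_mul_commutator_sub_transpose {D x u : Matrix n n ℝ} (hD : Dᵀ = D)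
    (h : ((D * x - x * D) * u).trace = 0) :
    (D * ((x - xᵀ) * (u + uᵀ) - (u + uᵀ) * (x - xᵀ))).trace =
      2 * ((D * x - x * D)ᵀ * u).trace := by
  have h1 : (D * ((x - xᵀ) * (u + uᵀ) - (u + uᵀ) * (x - xᵀ))).trace =
      (((D * x - x * D) + (D * x - x * D)ᵀ) * (u + uᵀ)).trace := by
    have : (D * ((u + uᵀ) * (x - xᵀ))).trace = ((x - xᵀ) * D * (u + uᵀ)).trace := by
      rw [← mul_assoc, trace_mul_comm, mul_assoc]
    rw [mul_sub, trace_sub, this, ← trace_sub, transpose_sub, transpose_mul, transpose_mul, hD]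
    congr 1
    noncomm_ring
  have h2 : ((D * x - x * D) * uᵀ).trace = ((D * x - x * D)ᵀ * u).trace := by
    rw [← trace_transpose, transpose_mul, transpose_transpose, trace_mul_comm]
  have h3 : ((D * x - x * D)ᵀ * uᵀ).trace = ((D * x - x * D) * u).trace := by
    rw [← trace_transpose, transpose_mul, transpose_transpose, transpose_transpose, trace_mul_comm]
  rw [h1, add_mul, mul_add, mul_add, trace_add, trace_add, trace_add, h2, h3, h]
  ring

theorem Matrix.trace_mul_transpose_conj {D J : Matrix n n ℝ} (hJ : Jᵀ * J = 1)
    (hJD : J * D = D * J) (M : Matrix n n ℝ) : (D * (Jᵀ * M * J)).trace = (D * M).trace := by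
  have hJ' : J * Jᵀ = 1 := mul_eq_one_comm.mp hJ
  rw [← mul_assoc, trace_mul_comm, ← mul_assoc, ← mul_assoc, hJD, mul_assoc D, hJ', mul_one]

theorem Matrix.transpose_eq_neg {J : Matrix n n ℝ} (hJ : Jᵀ * J = 1) (hJJ : J * J = -1) :
    Jᵀ = -J := by
  calc Jᵀ = Jᵀ * -(J * J) := by rw [hJJ, neg_neg, mul_one]
    _ = -J := by rw [mul_neg, ← mul_assoc, hJ, one_mul]

theorem commute_of_forall_le {a C J : Matrix n n ℝ} (hJ : Jᵀ * J = 1) (ha : aᵀ = a)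
    (hmin : ∀ W : Matrix n n ℝ, Wᵀ * W = 1 → ((a + Jᵀ * a * J - C) * (a + Jᵀ * a * J - C)).trace ≤
      ((W * a * Wᵀ + Jᵀ * (W * a * Wᵀ) * J - C) *
        (W * a * Wᵀ + Jᵀ * (W * a * Wᵀ) * J - C)).trace)
    {D : Matrix n n ℝ} (hD : a + Jᵀ * a * J - C = D) (hDt : Dᵀ = D) (hJD : J * D = D * J) :
    a * D = D * a := by
  set X := a * D - D * a with hX
  have hXt : Xᵀ = -X := by simp [hX, transpose_mul, ha, hDt]
  have h1 := (variation_of_forall_le hJ hXt (Y := 0) (by simp) (by simp) hmin hD rfl rfl rfl rfl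
    rfl rfl).1
  have h2 := trace_mul_transpose_conj hJ hJD
  have h3 : (D * (X * a - a * X)).trace = (X * X).trace := by
    have : (D * (X * a)).trace = (X * (a * D)).trace := by
      rw [trace_mul_comm, mul_assoc]
    rw [mul_sub, trace_sub, this, ← mul_assoc D, trace_mul_comm (D * a), ← trace_sub, ← mul_sub]
  have h4 : (Xᵀ * X).trace = 0 := by
    simp only [zero_mul, mul_zero, sub_zero, mul_add, trace_add, h2, h3] at h1
    rw [hXt, neg_mul, trace_neg]
    linarith
  have h5 : X = 0 := by
    rw [← conjTranspose_eq_transpose_of_trivial] at h4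
    exact Matrix.trace_conjTranspose_mul_self_eq_zero_iff.mp h4
  exact sub_eq_zero.mp h5

/-- The second variation of the distance at a minimiser rules out directions `u` on which the
spectrum of `a` increases while that of `C` decreases. -/
theorem eq_zero_of_add_conj_mem {P D a C J UA UC : Matrix n n ℝ} {SA SC : Finset n}
    {vA wA vC wC : n → ℝ} (hJ : Jᵀ * J = 1) (ha : aᵀ = a) (hC : Cᵀ = C)
    (hmin : ∀ W : Matrix n n ℝ, Wᵀ * W = 1 → ((a + Jᵀ * a * J - C) * (a + Jᵀ * a * J - C)).trace ≤
      ((W * a * Wᵀ + Jᵀ * (W * a * Wᵀ) * J - C) *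
        (W * a * Wᵀ + Jᵀ * (W * a * Wᵀ) * J - C)).trace)
    (hJJ : J * J = -1) (hJC : J * C = C * J)
    (hD : a + Jᵀ * a * J - C = D) (hDt : Dᵀ = D) (hJD : J * D = D * J) (hJP : J * P = P * J)
    (hA : IsAdaptedFrame P D a UA SA vA wA) (hCf : IsAdaptedFrame P D C UC SC vC wC)
    {u : Matrix n n ℝ} (hu : u ∈ maskSubmodule UA fun k l => (k ∉ SA ∧ l ∈ SA) ∧ vA k < vA l)
    (ht : u + J * u * Jᵀ ∈ maskSubmodule UC fun k l => vC l < vC k) : u = 0 := by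
  have hJ' : J * Jᵀ = 1 := mul_eq_one_comm.mp hJ
  have hJt := transpose_eq_neg hJ hJJ
  obtain ⟨x, hx, hxu⟩ := exists_commutator_eq hA.orth hA.mul_eq hu fun k l h => h.2.ne
  have huN := hA.mem_offBlock.mp (maskSubmodule_mono (fun k l h => h.1) hu)
  have hxN := hA.mem_offBlock.mp (maskSubmodule_mono (fun k l h => h.1) hx)
  have hconjN : ∀ z : Matrix n n ℝ, (1 - P) * z * P = z →
      (1 - P) * (J * z * Jᵀ) * P = J * z * Jᵀ := by
    intro z hz
    have h1 : (1 - P) * J = J * (1 - P) := by rw [sub_mul, mul_sub, hJP, one_mul, mul_one]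
    have h2 : Jᵀ * P = P * Jᵀ := by rw [hJt, neg_mul, mul_neg, hJP]
    calc (1 - P) * (J * z * Jᵀ) * P = ((1 - P) * J) * z * (Jᵀ * P) := by simp only [mul_assoc]
      _ = J * ((1 - P) * z * P) * Jᵀ := by rw [h1, h2]; simp only [mul_assoc]
      _ = _ := by rw [hz]
  obtain ⟨t, htdef⟩ : ∃ t, t = u + J * u * Jᵀ := ⟨_, rfl⟩
  rw [← htdef] at ht
  have htN : (1 - P) * t * P = t := by rw [htdef, mul_add, add_mul, huN, hconjN u huN]
  obtain ⟨z, hz, hzt⟩ := exists_commutator_eq hCf.orth hCf.mul_eq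
    (mem_maskSubmodule_and (hCf.mem_offBlock.mpr htN) ht) fun k l h => h.2.ne'
  have hzN := hCf.mem_offBlock.mp (maskSubmodule_mono (fun k l h => h.1) hz)
  have hconj2 : ∀ m : Matrix n n ℝ, J * (J * m * Jᵀ) * Jᵀ = m := fun m => by
    rw [hJt]
    calc J * (J * m * -J) * -J = (J * J) * m * (J * J) := by noncomm_ring
      _ = m := by rw [hJJ]; simp
  have htθ : J * t * Jᵀ = t := by rw [htdef, mul_add, add_mul, hconj2, add_comm]
  have hcomm : ∀ c m : Matrix n n ℝ, J * c = c * J →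
      c * (J * m * Jᵀ) - (J * m * Jᵀ) * c = J * (c * m - m * c) * Jᵀ := by
    intro c m hc
    have h2 : Jᵀ * c = c * Jᵀ := by rw [hJt, neg_mul, mul_neg, hc]
    calc _ = (c * J) * m * Jᵀ - J * m * (Jᵀ * c) := by simp only [mul_assoc]
      _ = _ := by rw [← hc, h2]; noncomm_ring
  set y := (1 / 2 : ℝ) • (z + J * z * Jᵀ) with hy
  have hyN : (1 - P) * y * P = y := by
    rw [hy, mul_smul_comm, smul_mul_assoc, mul_add, add_mul, hzN, hconjN z hzN]
  have hyt : C * y - y * C = t := by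
    rw [hy, mul_smul_comm, smul_mul_assoc, ← smul_sub, mul_add, add_mul, add_sub_add_comm,
      hcomm C z hJC, hzt, htθ, ← two_smul ℝ, smul_smul]
    norm_num
  have hJy : J * y = y * J := by
    have : J * y * Jᵀ = y := by
      rw [hy, mul_smul_comm, smul_mul_assoc, mul_add, add_mul, hconj2, add_comm]
    nth_rewrite 2 [← this]
    rw [mul_assoc, hJ, mul_one]
  have hyδ : ((D * y - y * D)ᵀ * t).trace = ((D * z - z * D)ᵀ * t).trace := by
    have h1 : ((D * (J * z * Jᵀ) - (J * z * Jᵀ) * D)ᵀ * t).trace =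
        ((D * z - z * D)ᵀ * t).trace := by
      nth_rewrite 1 [hcomm D z hJD, ← htθ]
      simp only [transpose_mul, transpose_transpose]
      generalize (D * z - z * D)ᵀ = δ
      have : J * (δ * Jᵀ) * (J * t * Jᵀ) = J * (δ * (Jᵀ * J) * t * Jᵀ) := by
        simp only [mul_assoc]
      rw [this, trace_mul_comm, hJ, mul_one, mul_assoc, hJ, mul_one]
    rw [hy, mul_smul_comm, smul_mul_assoc, ← smul_sub, mul_add, add_mul, add_sub_add_comm,
      transpose_smul, smul_mul_assoc, trace_smul, transpose_add, add_mul, trace_add, h1,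
      smul_eq_mul]
    ring
  have hvanish : ∀ m m' : Matrix n n ℝ, (1 - P) * m * P = m → (1 - P) * m' * P = m' →
      ((D * m - m * D) * m').trace = 0 := by
    intro m m' hm hm'
    have hP : P * (1 - P) = 0 := by rw [mul_sub, mul_one, hA.proj_mul_self, sub_self]
    have h1 : m * m' = 0 := by
      calc m * m' = (1 - P) * m * (P * (1 - P)) * m' * P := by
            nth_rewrite 1 [← hm, ← hm']; simp only [mul_assoc]
        _ = 0 := by rw [hP]; simp
    have h2 : m * D * m' = 0 := by
      calc m * D * m' = (1 - P) * m * (P * D) * (1 - P) * m' * P := by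
            nth_rewrite 1 [← hm, ← hm']; simp only [mul_assoc]
        _ = (1 - P) * m * D * (P * (1 - P)) * m' * P := by
            rw [← hA.commute_proj]; simp only [mul_assoc]
        _ = 0 := by rw [hP]; simp
    rw [sub_mul, mul_assoc, h1, h2, mul_zero, sub_zero, trace_zero]
  have hbr : ∀ c m m' : Matrix n n ℝ, cᵀ = c → c * m - m * c = m' →
      (m - mᵀ) * c - c * (m - mᵀ) = -(m' + m'ᵀ) := by
    intro c m m' hc hm
    rw [← hm, transpose_sub, transpose_mul, transpose_mul, hc]
    noncomm_ring
  have hvar := (variation_of_forall_le (X := x - xᵀ) (Y := y - yᵀ) hJ (by simp) (by simp) (by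
      have h2 := congrArg transpose hJy
      rw [transpose_mul, transpose_mul, hJt, mul_neg, neg_mul, neg_inj] at h2
      rw [mul_sub, sub_mul, hJy, h2]) hmin hD
    (hbr a x u ha hxu) (hbr C y t hC hyt) rfl rfl rfl rfl).2
  have hG₁ : -(u + uᵀ) + Jᵀ * (-(u + uᵀ)) * J - -(t + tᵀ) = 0 := by
    rw [htdef, hJt]
    simp only [transpose_add, transpose_mul, transpose_neg, hJt]
    noncomm_ring
  have hneg : ∀ m m' : Matrix n n ℝ, m * -m' - -m' * m = -(m * m' - m' * m) := fun m m' => by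
    noncomm_ring
  have e1 := trace_mul_commutator_sub_transpose hDt (hvanish x u hxN huN)
  have e2 := trace_mul_commutator_sub_transpose hDt (hvanish y t hyN htN)
  rw [hG₁, mul_zero, trace_zero, zero_add, mul_sub, mul_add, trace_sub, trace_add,
    trace_mul_transpose_conj hJ hJD, hneg, hneg, mul_neg, mul_neg, trace_neg, trace_neg, e1, e2,
    hyδ, ← hxu, ← hzt, hA.trace_commutator, hCf.trace_commutator] at hvar
  have hz0 : ∑ k, ∑ l, (wC k - wC l) * (vC k - vC l) * (UCᵀ * z * UC) k l ^ 2 ≤ 0 := by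
    refine Finset.sum_nonpos fun k _ => Finset.sum_nonpos fun l _ => ?_
    by_cases h : (k ∉ SC ∧ l ∈ SC) ∧ vC l < vC k
    · exact mul_nonpos_of_nonpos_of_nonneg (mul_nonpos_of_nonpos_of_nonneg
        (sub_nonpos.mpr (hCf.lt k h.1.1 l h.1.2).le) (sub_nonneg.mpr h.2.le)) (sq_nonneg _)
    · simp [hz k l h]
  have hx0 : x = 0 := by
    refine eq_zero_of_sum_mul_sq_nonpos (c := fun k l => (wA k - wA l) * (vA k - vA l))
      hA.orth (fun k l hne => ?_) (by linarith)
    have h : (k ∉ SA ∧ l ∈ SA) ∧ vA k < vA l := by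
      by_contra h
      exact hne (hx k l h)
    exact mul_pos_of_neg_of_neg (sub_neg.mpr (hA.lt k h.1.1 l h.1.2)) (sub_neg.mpr h.2)
  rw [← hxu, hx0, mul_zero, zero_mul, sub_zero]

end AdaptedFrames

section ConjugationInvolution

variable {n : Type*} [Fintype n] [DecidableEq n]

/-- The linear map `Z ↦ J Z Jᵀ`. -/
def Matrix.conjLinearMap (J : Matrix n n ℝ) : Matrix n n ℝ →ₗ[ℝ] Matrix n n ℝ where
  toFun Z := J * Z * Jᵀ
  map_add' x y := by rw [mul_add, add_mul]
  map_smul' c x := by simp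

theorem Matrix.conjLinearMap_apply (J Z : Matrix n n ℝ) : conjLinearMap J Z = J * Z * Jᵀ := rfl

variable {U J : Matrix n n ℝ} {r : n → n → Prop}

theorem Matrix.transpose_conj_conjLinearMap (hU : Uᵀ * U = 1) (Z : Matrix n n ℝ) :
    Uᵀ * conjLinearMap J Z * U = (Uᵀ * J * U) * (Uᵀ * Z * U) * (Uᵀ * J * U)ᵀ := by
  have hU' : U * Uᵀ = 1 := mul_eq_one_comm.mp hU
  have : (Uᵀ * J * U) * (Uᵀ * Z * U) * (Uᵀ * J * U)ᵀ =
      Uᵀ * J * (U * Uᵀ) * Z * (U * Uᵀ) * Jᵀ * U := by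
    simp only [transpose_mul, transpose_transpose, mul_assoc]
  rw [this, hU', conjLinearMap_apply]
  simp only [mul_assoc, mul_one]

theorem Matrix.conjLinearMap_mem_maskSubmodule (hU : Uᵀ * U = 1)
    (hr : ∀ k l i j, (Uᵀ * J * U) k i ≠ 0 → (Uᵀ * J * U) l j ≠ 0 → r i j → r k l)
    {Z : Matrix n n ℝ} (hZ : Z ∈ maskSubmodule U r) :
    conjLinearMap J Z ∈ maskSubmodule U r := by
  intro k l hkl
  rw [transpose_conj_conjLinearMap hU, mul_apply]
  refine Finset.sum_eq_zero fun j _ => ?_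
  by_cases hj : (Uᵀ * J * U) l j = 0
  · rw [transpose_apply, hj, mul_zero]
  · rw [mul_apply, Finset.sum_eq_zero, zero_mul]
    intro i _
    by_cases hi : (Uᵀ * J * U) k i = 0
    · rw [hi, zero_mul]
    · rw [hZ i j fun h => hkl (hr k l i j hi hj h), mul_zero]

theorem Matrix.trace_maskProj_comp_conjLinearMap (hU : Uᵀ * U = 1)
    (hJ : ∀ k, (Uᵀ * J * U) k k = 0) :
    LinearMap.trace ℝ _ (maskProj U r ∘ₗ conjLinearMap J) = 0 := by
  have hU' : U * Uᵀ = 1 := mul_eq_one_comm.mp hU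
  let e : Matrix n n ℝ ≃ₗ[ℝ] Matrix n n ℝ :=
    LinearEquiv.ofLinearMap (conjLinearMap U) (conjLinearMap Uᵀ)
      (LinearMap.ext fun Z => by
        simpa [conjLinearMap_apply] using conj_transpose_conj hU Z)
      (LinearMap.ext fun Z => by
        simpa [conjLinearMap_apply] using transpose_conj_conj hU Z)
  have hsymm : ∀ Z, e.symm Z = Uᵀ * Z * U := fun Z => by
    change conjLinearMap Uᵀ Z = _
    rw [conjLinearMap_apply, transpose_transpose]
  have he : ∀ Z, e Z = U * Z * Uᵀ := fun Z => rfl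
  rw [LinearMap.trace_eq_matrix_trace ℝ ((Matrix.stdBasis ℝ n n).map e), trace]
  refine Finset.sum_eq_zero fun kl _ => ?_
  rw [diag_apply, LinearMap.toMatrix_apply, Module.Basis.map_repr, Module.Basis.map_apply,
    LinearEquiv.trans_apply]
  obtain ⟨k, l⟩ := kl
  rw [hsymm, LinearMap.comp_apply, he, Matrix.stdBasis_eq_single]
  have hrepr : ∀ M : Matrix n n ℝ, (Matrix.stdBasis ℝ n n).repr M (k, l) = M k l := fun M => rfl
  rw [hrepr, transpose_conj_maskProj hU, transpose_conj_conjLinearMap hU, transpose_conj_conj hU]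
  have : (Uᵀ * J * U * single k l (1 : ℝ) * (Uᵀ * J * U)ᵀ) k l = 0 := by
    rw [mul_apply]
    refine Finset.sum_eq_zero fun j _ => ?_
    by_cases hj : j = l
    · rw [hj, transpose_apply, hJ, mul_zero]
    · rw [Matrix.mul_single_apply_of_ne (hbj := hj), zero_mul]
  rw [this, ite_self]

theorem Matrix.conjLinearMap_conjLinearMap (hJ : Jᵀ * J = 1) (hJJ : J * J = -1)
    (Z : Matrix n n ℝ) : conjLinearMap J (conjLinearMap J Z) = Z := by
  rw [conjLinearMap_apply, conjLinearMap_apply, transpose_eq_neg hJ hJJ]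
  calc J * (J * Z * -J) * -J = (J * J) * Z * (J * J) := by noncomm_ring
    _ = Z := by rw [hJJ]; simp

theorem Matrix.maskProj_conjLinearMap (hU : Uᵀ * U = 1)
    (hr : ∀ k l i j, (Uᵀ * J * U) k i ≠ 0 → (Uᵀ * J * U) l j ≠ 0 → (r i j ↔ r k l))
    (Z : Matrix n n ℝ) :
    maskProj U r (conjLinearMap J Z) = conjLinearMap J (maskProj U r Z) := by
  have hmem : ∀ Z, Z ∈ maskSubmodule U r → conjLinearMap J Z ∈ maskSubmodule U r := fun Z hZ =>
    conjLinearMap_mem_maskSubmodule hU (fun k l i j hi hj => (hr k l i j hi hj).mp) hZ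
  have hmem' : ∀ Z, Z ∈ maskSubmodule U (fun k l => ¬ r k l) →
      conjLinearMap J Z ∈ maskSubmodule U (fun k l => ¬ r k l) := fun Z hZ =>
    conjLinearMap_mem_maskSubmodule hU (fun k l i j hi hj => (not_congr (hr k l i j hi hj)).mp) hZ
  have h1 : Z = maskProj U r Z + (Z - maskProj U r Z) := by abel
  nth_rewrite 1 [h1]
  rw [map_add, map_add, maskProj_eq_self hU (hmem _ (maskProj_mem hU Z)),
    maskProj_eq_zero hU (hmem' _ (sub_maskProj_mem hU Z)), add_zero]

theorem Matrix.finrank_maskSubmodule_inf_eq (hU : Uᵀ * U = 1) (hJ : Jᵀ * J = 1) (hJJ : J * J = -1)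
    (hr : ∀ k l i j, (Uᵀ * J * U) k i ≠ 0 → (Uᵀ * J * U) l j ≠ 0 → (r i j ↔ r k l)) :
    Module.finrank ℝ ↥(maskSubmodule U r ⊓ LinearMap.ker (conjLinearMap J - LinearMap.id)) =
      Module.finrank ℝ ↥(maskSubmodule U r ⊓ LinearMap.ker (conjLinearMap J + LinearMap.id)) := by
  have hJt := transpose_eq_neg hJ hJJ
  have hinv := conjLinearMap_conjLinearMap hJ hJJ
  have hcomm := maskProj_conjLinearMap hU hr
  have hp : LinearMap.IsProj (maskSubmodule U r ⊓ LinearMap.ker (conjLinearMap J - LinearMap.id))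
      ((1 / 2 : ℝ) • (maskProj U r + maskProj U r ∘ₗ conjLinearMap J)) := by
    refine ⟨fun Z => ⟨Submodule.smul_mem _ _ (Submodule.add_mem _ (maskProj_mem hU _)
      (maskProj_mem hU _)), ?_⟩, fun Z hZ => ?_⟩
    · refine LinearMap.mem_ker.mpr ?_
      simp only [LinearMap.smul_apply, LinearMap.add_apply, LinearMap.comp_apply,
        LinearMap.sub_apply, LinearMap.id_apply, map_smul, map_add, hcomm, hinv]
      rw [sub_add_sub_cancel, sub_self, smul_zero]
    · have h1 : conjLinearMap J Z = Z := sub_eq_zero.mp hZ.2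
      simp only [LinearMap.smul_apply, LinearMap.add_apply, LinearMap.comp_apply, h1,
        maskProj_eq_self hU hZ.1]
      rw [← two_smul ℝ, smul_smul]
      norm_num
  have hm : LinearMap.IsProj (maskSubmodule U r ⊓ LinearMap.ker (conjLinearMap J + LinearMap.id))
      ((1 / 2 : ℝ) • (maskProj U r - maskProj U r ∘ₗ conjLinearMap J)) := by
    refine ⟨fun Z => ⟨Submodule.smul_mem _ _ (Submodule.sub_mem _ (maskProj_mem hU _)
      (maskProj_mem hU _)), ?_⟩, fun Z hZ => ?_⟩
    · refine LinearMap.mem_ker.mpr ?_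
      simp only [LinearMap.smul_apply, LinearMap.sub_apply, LinearMap.comp_apply,
        LinearMap.add_apply, LinearMap.id_apply, map_smul, map_sub, hcomm, hinv]
      rw [add_comm, sub_self, smul_zero]
    · have h1 : conjLinearMap J Z = -Z := eq_neg_of_add_eq_zero_left hZ.2
      simp only [LinearMap.smul_apply, LinearMap.sub_apply, LinearMap.comp_apply, h1, map_neg,
        maskProj_eq_self hU hZ.1]
      rw [sub_neg_eq_add, ← two_smul ℝ, smul_smul]
      norm_num
  have hdiag : ∀ k, (Uᵀ * J * U) k k = 0 := by
    intro k
    have h1 : (Uᵀ * J * U)ᵀ = -(Uᵀ * J * U) := by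
      rw [transpose_mul, transpose_mul, transpose_transpose, hJt]
      simp [mul_assoc]
    have h2 := congrFun (congrFun h1 k) k
    rw [transpose_apply, neg_apply] at h2
    linarith
  have h1 := hp.trace
  have h2 := hm.trace
  rw [map_smul, map_add, trace_maskProj_comp_conjLinearMap hU hdiag] at h1
  rw [map_smul, map_sub, trace_maskProj_comp_conjLinearMap hU hdiag] at h2
  rw [add_zero] at h1
  rw [sub_zero] at h2
  exact_mod_cast h1.symm.trans h2

end ConjugationInvolution

section DimensionCount

variable {n : Type*} [Fintype n] [DecidableEq n]

theorem Matrix.mem_maskSubmodule_of_commute {U J a : Matrix n n ℝ} {v : n → ℝ} (hU : Uᵀ * U = 1)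
    (ha : a * U = U * diagonal v) (h : J * a = a * J) {k l : n} (hkl : (Uᵀ * J * U) k l ≠ 0) :
    v k = v l := by
  have := transpose_conj_commutator hU ha J k l
  rw [h, sub_self, mul_zero, zero_mul, zero_apply] at this
  exact sub_eq_zero.mp ((mul_eq_zero.mp this.symm).resolve_right hkl)

namespace Matrix.IsAdaptedFrame

variable {P D a U J : Matrix n n ℝ} {S : Finset n} {v w : n → ℝ}

theorem mem_iff_of_ne_zero (h : IsAdaptedFrame P D a U S v w) (hJP : J * P = P * J) {k l : n}
    (hkl : (Uᵀ * J * U) k l ≠ 0) : k ∈ S ↔ l ∈ S := by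
  have := mem_maskSubmodule_of_commute h.orth h.proj_mul_eq hJP hkl
  by_cases hk : k ∈ S <;> by_cases hl : l ∈ S <;> simp_all

theorem conjLinearMap_mem_offBlock (h : IsAdaptedFrame P D a U S v w) (hJP : J * P = P * J)
    {Z : Matrix n n ℝ} (hZ : Z ∈ maskSubmodule U fun k l => k ∉ S ∧ l ∈ S) :
    conjLinearMap J Z ∈ maskSubmodule U fun k l => k ∉ S ∧ l ∈ S :=
  conjLinearMap_mem_maskSubmodule h.orth (fun _ _ _ _ hi hj hij =>
    ⟨(not_congr (h.mem_iff_of_ne_zero hJP hi)).mpr hij.1, (h.mem_iff_of_ne_zero hJP hj).mpr hij.2⟩)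
    hZ

end Matrix.IsAdaptedFrame

theorem Matrix.trace_transpose_mul_conjLinearMap {J : Matrix n n ℝ} (hJt : Jᵀ = -J)
    (x y : Matrix n n ℝ) :
    (xᵀ * conjLinearMap J y).trace = ((conjLinearMap J x)ᵀ * y).trace := by
  rw [conjLinearMap_apply, conjLinearMap_apply, ← mul_assoc, trace_mul_comm]
  simp only [transpose_mul, transpose_transpose]
  rw [hJt]
  congr 1
  noncomm_ring

theorem Matrix.eq_zero_of_trace_transpose_mul_self {m : Type*} [Fintype m] {x : Matrix m m ℝ}
    (h : (xᵀ * x).trace = 0) : x = 0 := by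
  rw [← conjTranspose_eq_transpose_of_trivial] at h
  exact Matrix.trace_conjTranspose_mul_self_eq_zero_iff.mp h

section

variable {P D a C J UA UC : Matrix n n ℝ} {SA SC : Finset n} {vA wA vC wC : n → ℝ}

/-- On anti-invariant matrices on which `C` is nonpositive, the increasing part for `a` is
injective. -/
theorem eq_zero_of_conj_eq_neg (hJ : Jᵀ * J = 1) (hJJ : J * J = -1)
    (hD : a + Jᵀ * a * J - C = D)
    (hA : IsAdaptedFrame P D a UA SA vA wA) (hCf : IsAdaptedFrame P D C UC SC vC wC)
    {z : Matrix n n ℝ} (hz : z ∈ maskSubmodule UC fun k l => (k ∉ SC ∧ l ∈ SC) ∧ vC k ≤ vC l)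
    (hθ : conjLinearMap J z = -z)
    (h0 : maskProj UA (fun k l => (k ∉ SA ∧ l ∈ SA) ∧ vA k < vA l) z = 0) : z = 0 := by
  have hJt := transpose_eq_neg hJ hJJ
  have hzA := hA.mem_offBlock.mpr (hCf.mem_offBlock.mp (maskSubmodule_mono (fun k l h => h.1) hz))
  have hzA' := mem_maskSubmodule_and hzA (mem_maskSubmodule_of_maskProj_eq_zero hA.orth h0)
  have h1 : 0 ≤ (zᵀ * (a * z - z * a)).trace := by
    rw [hA.trace_mul_commutator]
    refine Finset.sum_nonneg fun k _ => Finset.sum_nonneg fun l _ => ?_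
    by_cases h : (k ∉ SA ∧ l ∈ SA) ∧ ¬ ((k ∉ SA ∧ l ∈ SA) ∧ vA k < vA l)
    · have : vA l ≤ vA k := not_lt.mp fun h' => h.2 ⟨h.1, h'⟩
      exact mul_nonneg (sub_nonneg.mpr this) (sq_nonneg _)
    · simp [hzA' k l h]
  have h2 : (zᵀ * (C * z - z * C)).trace ≤ 0 := by
    rw [hCf.trace_mul_commutator]
    refine Finset.sum_nonpos fun k _ => Finset.sum_nonpos fun l _ => ?_
    by_cases h : (k ∉ SC ∧ l ∈ SC) ∧ vC k ≤ vC l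
    · exact mul_nonpos_of_nonpos_of_nonneg (sub_nonpos.mpr h.2) (sq_nonneg _)
    · simp [hz k l h]
  have h3 : (zᵀ * (Jᵀ * a * J * z - z * (Jᵀ * a * J))).trace =
      (zᵀ * (a * z - z * a)).trace := by
    have e : Jᵀ * a * J * z - z * (Jᵀ * a * J) = conjLinearMap J (-(a * z - z * a)) := by
      have hl : z * J = -(J * z) := by
        have hz' : z = -(J * z * Jᵀ) := by rw [← conjLinearMap_apply, hθ, neg_neg]
        nth_rewrite 1 [hz']
        rw [neg_mul, mul_assoc, hJ, mul_one]
      have hl' : J * z = -(z * J) := by rw [hl, neg_neg]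
      rw [conjLinearMap_apply, hJt]
      calc -J * a * J * z - z * (-J * a * J) = -(J * a * (J * z)) + z * J * a * J := by
            noncomm_ring
        _ = -(J * a * (-(z * J))) + -(J * z) * a * J := by rw [← hl', ← hl]
        _ = J * -(a * z - z * a) * -J := by noncomm_ring
    rw [e, trace_transpose_mul_conjLinearMap hJt, hθ, transpose_neg, neg_mul_neg]
  have h4 : Jᵀ * a * J * z - z * (Jᵀ * a * J) =
      (C * z - z * C) + (D * z - z * D) - (a * z - z * a) := by
    rw [← hD]; noncomm_ring
  have h5 : 0 ≤ (zᵀ * (D * z - z * D)).trace := by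
    rw [h4, mul_sub, mul_add, trace_sub, trace_add] at h3
    linarith
  rw [hA.trace_mul_defect_commutator] at h5
  refine eq_zero_of_sum_mul_sq_nonpos (c := fun k l => wA l - wA k) hA.orth (fun k l hne => ?_) ?_
  · have h : k ∉ SA ∧ l ∈ SA := by
      by_contra h
      exact hne (hzA k l h)
    exact sub_pos.mpr (hA.lt k h.1 l h.2)
  · rw [← neg_nonneg, ← Finset.sum_neg_distrib]
    refine h5.trans_eq (Finset.sum_congr rfl fun k _ => ?_)
    rw [← Finset.sum_neg_distrib]
    exact Finset.sum_congr rfl fun l _ => by ring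

theorem eq_zero_of_sub_conj_mem (hJ : Jᵀ * J = 1) (hJJ : J * J = -1) (hJC : J * C = C * J)
    (hJP : J * P = P * J) (hD : a + Jᵀ * a * J - C = D)
    (hA : IsAdaptedFrame P D a UA SA vA wA) (hCf : IsAdaptedFrame P D C UC SC vC wC)
    (hplus : ∀ u ∈ maskSubmodule UA fun k l => (k ∉ SA ∧ l ∈ SA) ∧ vA k < vA l,
      u + conjLinearMap J u ∈ maskSubmodule UC (fun k l => vC l < vC k) → u = 0)
    {u : Matrix n n ℝ} (hu : u ∈ maskSubmodule UA fun k l => (k ∉ SA ∧ l ∈ SA) ∧ vA k < vA l)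
    (ht : u - conjLinearMap J u ∈ maskSubmodule UC fun k l => vC l < vC k) : u = 0 := by
  have hJt := transpose_eq_neg hJ hJJ
  have hinv := conjLinearMap_conjLinearMap hJ hJJ
  set rA : n → n → Prop := fun k l => (k ∉ SA ∧ l ∈ SA) ∧ vA k < vA l with hrA
  set rC : n → n → Prop := fun k l => (k ∉ SC ∧ l ∈ SC) ∧ vC k ≤ vC l with hrC
  have hr : ∀ k l i j, (UCᵀ * J * UC) k i ≠ 0 → (UCᵀ * J * UC) l j ≠ 0 → (rC i j ↔ rC k l) := by
    intro k l i j hi hj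
    simp only [hrC, mem_maskSubmodule_of_commute hCf.orth hCf.mul_eq hJC hi,
      mem_maskSubmodule_of_commute hCf.orth hCf.mul_eq hJC hj,
      hCf.mem_iff_of_ne_zero hJP hi, hCf.mem_iff_of_ne_zero hJP hj]
  have hcomm := maskProj_conjLinearMap hCf.orth hr
  have hfin := finrank_maskSubmodule_inf_eq hCf.orth hJ hJJ hr
  have hle : Module.finrank ℝ (maskSubmodule UA rA) ≤ Module.finrank ℝ
      ↥(maskSubmodule UC rC ⊓ LinearMap.ker (conjLinearMap J - LinearMap.id)) := by
    let f := (maskProj UC rC ∘ₗ (LinearMap.id + conjLinearMap J)).domRestrict (maskSubmodule UA rA)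
    have hf : Function.Injective f := by
      rw [← LinearMap.ker_eq_bot, LinearMap.ker_eq_bot']
      rintro ⟨x, hx⟩ hfx
      have h1 : maskProj UC rC (x + conjLinearMap J x) = 0 := hfx
      have h2 := mem_maskSubmodule_of_maskProj_eq_zero hCf.orth h1
      have hxN := hA.mem_offBlock.mp (maskSubmodule_mono (fun k l h => h.1) hx)
      have hxC := hCf.mem_offBlock.mpr hxN
      have h3 := mem_maskSubmodule_and h2
        (add_mem hxC (hCf.conjLinearMap_mem_offBlock hJP hxC))
      exact Subtype.ext (hplus x hx (maskSubmodule_mono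
        (fun k l h => not_le.mp fun h' => h.1 ⟨h.2, h'⟩) h3))
    rw [← LinearMap.finrank_range_of_inj hf]
    refine Submodule.finrank_mono ?_
    rintro _ ⟨⟨x, hx⟩, rfl⟩
    refine ⟨maskProj_mem hCf.orth _, LinearMap.mem_ker.mpr ?_⟩
    change conjLinearMap J (maskProj UC rC (x + conjLinearMap J x)) -
      maskProj UC rC (x + conjLinearMap J x) = 0
    rw [← hcomm, map_add, hinv, add_comm, sub_self]
  let g := (maskProj UA rA).domRestrict
    (maskSubmodule UC rC ⊓ LinearMap.ker (conjLinearMap J + LinearMap.id))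
  have hg : Function.Injective g := by
    rw [← LinearMap.ker_eq_bot, LinearMap.ker_eq_bot']
    rintro ⟨x, hx⟩ hgx
    exact Subtype.ext (eq_zero_of_conj_eq_neg hJ hJJ hD hA hCf hx.1
      (eq_neg_of_add_eq_zero_left hx.2) hgx)
  have hrange : LinearMap.range g = maskSubmodule UA rA := by
    refine Submodule.eq_of_le_of_finrank_le ?_ ?_
    · rintro _ ⟨x, rfl⟩
      exact maskProj_mem hA.orth _
    · rw [LinearMap.finrank_range_of_inj hg, ← hfin]
      exact hle
  obtain ⟨⟨z, hz⟩, hzu⟩ : u ∈ LinearMap.range g := hrange ▸ hu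
  have hzu' : maskProj UA rA z = u := hzu
  have hzθ : conjLinearMap J z = -z := eq_neg_of_add_eq_zero_left hz.2
  have h1 : (zᵀ * (u - conjLinearMap J u)).trace = 0 :=
    trace_transpose_mul_eq_zero_of_disjoint hCf.orth hz.1 ht fun k l h => not_lt.mpr h.2
  have h2 : (zᵀ * u).trace = 0 := by
    rw [mul_sub, trace_sub, trace_transpose_mul_conjLinearMap hJt, hzθ, transpose_neg, neg_mul,
      trace_neg] at h1
    linarith
  have h3 : ((z - u)ᵀ * u).trace = 0 := by
    have h := sub_maskProj_mem (r := rA) hA.orth z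
    rw [hzu'] at h
    exact trace_transpose_mul_eq_zero_of_disjoint hA.orth h hu fun k l h => h
  refine eq_zero_of_trace_transpose_mul_self ?_
  rw [transpose_sub, sub_mul, trace_sub, h2] at h3
  linarith

theorem eq_zero_of_add_add_eq_zero (hJ : Jᵀ * J = 1) (hJJ : J * J = -1) (hJC : J * C = C * J)
    (hJP : J * P = P * J) (hD : a + Jᵀ * a * J - C = D)
    (hA : IsAdaptedFrame P D a UA SA vA wA) (hCf : IsAdaptedFrame P D C UC SC vC wC)
    (hplus : ∀ u ∈ maskSubmodule UA fun k l => (k ∉ SA ∧ l ∈ SA) ∧ vA k < vA l,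
      u + conjLinearMap J u ∈ maskSubmodule UC (fun k l => vC l < vC k) → u = 0)
    {x y z : Matrix n n ℝ} (hx : x ∈ maskSubmodule UA fun k l => (k ∉ SA ∧ l ∈ SA) ∧ vA k < vA l)
    (hy : conjLinearMap J y ∈ maskSubmodule UA fun k l => (k ∉ SA ∧ l ∈ SA) ∧ vA k < vA l)
    (hz : z ∈ maskSubmodule UC fun k l => vC l < vC k) (h : x + y + z = 0) :
    x = 0 ∧ y = 0 ∧ z = 0 := by
  have hJt := transpose_eq_neg hJ hJJ
  have hinv := conjLinearMap_conjLinearMap hJ hJJ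
  have hzθ : conjLinearMap J z ∈ maskSubmodule UC fun k l => vC l < vC k := by
    refine conjLinearMap_mem_maskSubmodule hCf.orth (fun k l i j hi hj hij => ?_) hz
    rwa [mem_maskSubmodule_of_commute hCf.orth hCf.mul_eq hJC hi,
      mem_maskSubmodule_of_commute hCf.orth hCf.mul_eq hJC hj]
  have hz' : z = -(x + y) := by rw [eq_neg_iff_add_eq_zero, add_comm, h]
  have h1 : x + conjLinearMap J y = 0 := by
    refine hplus _ (add_mem hx hy) ?_
    have : x + conjLinearMap J y + conjLinearMap J (x + conjLinearMap J y) =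
        -(z + conjLinearMap J z) := by
      rw [hz', map_neg, map_add, map_add, hinv]; abel
    rw [this]
    exact neg_mem (add_mem hz hzθ)
  have h2 : x - conjLinearMap J y = 0 := by
    refine eq_zero_of_sub_conj_mem hJ hJJ hJC hJP hD hA hCf hplus (sub_mem hx hy) ?_
    have : x - conjLinearMap J y - conjLinearMap J (x - conjLinearMap J y) =
        -(z - conjLinearMap J z) := by
      rw [hz', map_neg, map_add, map_sub, hinv]; abel
    rw [this]
    exact neg_mem (sub_mem hz hzθ)
  have hx0 : x = 0 := by
    have : (2 : ℝ) • x = (x + conjLinearMap J y) + (x - conjLinearMap J y) := by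
      rw [two_smul]; abel
    rw [h1, h2, add_zero] at this
    simpa using this
  have hy0 : y = 0 := by
    rw [hx0, zero_add] at h1
    rw [← hinv y, h1, map_zero]
  exact ⟨hx0, hy0, by rw [hz', hx0, hy0]; simp⟩

end

end DimensionCount

section TopEigenspace

variable {n : Type*} [Fintype n] [DecidableEq n]

theorem Matrix.isCompact_setOf_transpose_mul_self_eq_one :
    IsCompact {U : Matrix n n ℝ | Uᵀ * U = 1} := by
  have hbox : IsCompact (Set.univ.pi fun _ : n => Set.univ.pi fun _ : n => Set.Icc (-1 : ℝ) 1) :=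
    isCompact_univ_pi fun _ => isCompact_univ_pi fun _ => isCompact_Icc
  refine IsCompact.of_isClosed_subset hbox (isClosed_eq (by fun_prop) (by fun_prop)) ?_
  intro U hU i _ j _
  have h1 := congrFun (congrFun (show Uᵀ * U = 1 from hU) j) j
  rw [mul_apply, one_apply_eq] at h1
  have h2 : U i j * U i j ≤ 1 := by
    rw [← h1]
    exact Finset.single_le_sum (f := fun k => Uᵀ j k * U k j)
      (fun k _ => mul_self_nonneg (U k j)) (Finset.mem_univ i)
  exact ⟨by nlinarith, by nlinarith⟩

theorem Matrix.conj_diagonal_comp_mul {D U V : Matrix n n ℝ} {v w : n → ℝ} (hU : Uᵀ * U = 1)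
    (hDU : D * U = U * diagonal v) (hDV : D * V = V * diagonal w) (f : ℝ → ℝ) :
    U * diagonal (f ∘ v) * Uᵀ * V = V * diagonal (f ∘ w) := by
  have hU' : U * Uᵀ = 1 := mul_eq_one_comm.mp hU
  have h1 : diagonal v * (Uᵀ * V) = (Uᵀ * V) * diagonal w := by
    have : Uᵀ * D = diagonal v * Uᵀ := by
      calc Uᵀ * D = Uᵀ * (D * U) * Uᵀ := by rw [mul_assoc, mul_assoc, hU', mul_one]
        _ = _ := by rw [hDU, ← mul_assoc, hU, one_mul]
    rw [← mul_assoc, ← this, mul_assoc, hDV, mul_assoc]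
  have h2 : diagonal (f ∘ v) * (Uᵀ * V) = (Uᵀ * V) * diagonal (f ∘ w) := by
    ext k l
    have := congrFun (congrFun h1 k) l
    rw [diagonal_mul, mul_diagonal] at this ⊢
    by_cases h0 : (Uᵀ * V) k l = 0
    · rw [h0, mul_zero, zero_mul]
    · rw [mul_comm] at this
      rw [mul_comm, Function.comp_apply, Function.comp_apply, mul_left_cancel₀ h0 this]
  rw [mul_assoc, mul_assoc, h2, ← mul_assoc, ← mul_assoc, hU', one_mul]

theorem Matrix.exists_eq_of_mul_eq_mul_diagonal {D U V : Matrix n n ℝ} {v w : n → ℝ}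
    (hU : Uᵀ * U = 1) (hV : Vᵀ * V = 1) (hDU : D * U = U * diagonal v)
    (hDV : D * V = V * diagonal w) (l : n) : ∃ k, v k = w l := by
  classical
  by_contra! h
  have h1 := conj_diagonal_comp_mul hU hDU hDV fun t => if t = w l then 1 else 0
  have h2 : ((fun t => if t = w l then (1 : ℝ) else 0) ∘ v) = 0 := by
    ext k
    simp [h k]
  rw [h2, show (diagonal (0 : n → ℝ) : Matrix n n ℝ) = 0 from diagonal_zero, mul_zero, zero_mul,
    zero_mul] at h1
  have h3 : diagonal ((fun t => if t = w l then (1 : ℝ) else 0) ∘ w) = 0 := by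
    rw [← one_mul (diagonal _), ← hV, mul_assoc, ← h1, mul_zero]
  simpa using congrFun (congrFun h3 l) l

/-- A nonzero trace-free symmetric matrix has a projection onto its top eigenspace that is
adapted to simultaneous eigenframes with each of two commuting symmetric matrices. -/
theorem Matrix.exists_isAdaptedFrame {a C D : Matrix n n ℝ} (ha : a.IsSymm) (hC : C.IsSymm)
    (hD : D.IsSymm) (haD : a * D = D * a) (hCD : C * D = D * C) (hD0 : D ≠ 0)
    (htr : D.trace = 0) :
    ∃ (P UA UC : Matrix n n ℝ) (SA SC : Finset n) (vA wA vC wC : n → ℝ),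
      IsAdaptedFrame P D a UA SA vA wA ∧ IsAdaptedFrame P D C UC SC vC wC ∧
      Pᵀ = P ∧ (∀ J : Matrix n n ℝ, J * D = D * J → J * P = P * J) ∧
      0 < ∑ k ∈ SA, wA k := by
  obtain ⟨U, v, w, hU, hav, hDw⟩ := ha.exists_simultaneous_diagonalization hD haD
  obtain ⟨V, c, w', hV, hCc, hDw'⟩ := hC.exists_simultaneous_diagonalization hD hCD
  have hU' : U * Uᵀ = 1 := mul_eq_one_comm.mp hU
  have hDeq : D = U * diagonal w * Uᵀ := by rw [← hDw, mul_assoc, hU', mul_one]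
  have hsum : ∑ k, w k = 0 := by
    rw [← htr, hDeq, trace_mul_comm, ← mul_assoc, hU, one_mul, trace_diagonal]
  obtain ⟨k₁, hk₁⟩ : ∃ k, w k ≠ 0 := by
    by_contra! h
    exact hD0 (by rw [hDeq, show w = 0 from funext h]; simp)
  obtain ⟨k₀, -, hk₀⟩ := Finset.exists_max_image Finset.univ w ⟨k₁, Finset.mem_univ _⟩
  have hpos : 0 < w k₀ := by
    by_contra! h
    have := (Finset.sum_eq_zero_iff_of_nonpos fun k _ => (hk₀ k (Finset.mem_univ k)).trans h).mp
      hsum k₁ (Finset.mem_univ _)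
    exact hk₁ this
  have hle' : ∀ l, w' l ≤ w k₀ := fun l => by
    obtain ⟨k, hk⟩ := exists_eq_of_mul_eq_mul_diagonal hU hV hDw hDw' l
    rw [← hk]
    exact hk₀ k (Finset.mem_univ k)
  let f : ℝ → ℝ := fun t => if t = w k₀ then 1 else 0
  have hind : ∀ u : n → ℝ, f ∘ u = fun k => if k ∈ Finset.univ.filter (fun k => u k = w k₀)
      then 1 else 0 := fun u => by
    ext k
    simp [f]
  refine ⟨U * diagonal (f ∘ w) * Uᵀ, U, V, Finset.univ.filter fun k => w k = w k₀,
    Finset.univ.filter fun k => w' k = w k₀, v, w, c, w', ⟨hU, hav, hDw, ?_, ?_⟩,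
    ⟨hV, hCc, hDw', ?_, ?_⟩, ?_, ?_, ?_⟩
  · rw [mul_assoc, hU, mul_one, hind]
  · intro k hk l hl
    simp only [Finset.mem_filter, Finset.mem_univ, true_and] at hk hl
    rw [hl]
    exact lt_of_le_of_ne (hk₀ k (Finset.mem_univ k)) hk
  · rw [conj_diagonal_comp_mul hU hDw hDw', hind]
  · intro k hk l hl
    simp only [Finset.mem_filter, Finset.mem_univ, true_and] at hk hl
    rw [hl]
    exact lt_of_le_of_ne (hle' k) hk
  · simp [transpose_mul, mul_assoc]
  · intro J hJD
    have h1 := conj_diagonal_comp_mul (V := J * U) hU hDw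
      (by rw [← mul_assoc, ← hJD, mul_assoc, hDw, mul_assoc]) f
    calc J * (U * diagonal (f ∘ w) * Uᵀ) = (J * U * diagonal (f ∘ w)) * Uᵀ := by
          simp only [mul_assoc]
      _ = U * diagonal (f ∘ w) * Uᵀ * J * (U * Uᵀ) := by rw [← h1]; simp only [mul_assoc]
      _ = _ := by rw [hU', mul_one]
  · refine Finset.sum_pos (fun k hk => ?_) ⟨k₀, by simp⟩
    rw [(Finset.mem_filter.mp hk).2]
    exact hpos

end TopEigenspace

section RealWeights

variable {n ι : Type*} [Fintype n] [DecidableEq n] [Fintype ι]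

omit [DecidableEq n] in
theorem Matrix.map_ofReal_mul_mul (L : ℂ →ₗ[ℝ] ℝ) (M N : Matrix n n ℝ) (z : Matrix n n ℂ) :
    (M.map Complex.ofReal * z * N.map Complex.ofReal).map L = M * z.map L * N := by
  ext i j
  simp only [map_apply, mul_apply, map_sum, Finset.sum_mul]
  refine Finset.sum_congr rfl fun l _ => Finset.sum_congr rfl fun k _ => ?_
  have : (M i k : ℂ) * z k l * (N l j : ℂ) = (M i k * N l j) • z k l := by
    rw [Complex.real_smul]
    push_cast
    ring
  rw [this, map_smul, smul_eq_mul]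
  ring

/-- If the flags of the frames `Uᵢ` are in general position relative to `P`, then orthogonal
conjugates of the diagonal weights that add up to zero force the total weight of the flags to be
nonpositive. -/
theorem sum_weight_nonpos [Nonempty ι] (P : Matrix n n ℝ) (hP : P * P = P) (hPt : Pᵀ = P)
    (U : ι → Matrix n n ℝ) (hU : ∀ i, (U i)ᵀ * U i = 1) (S : ι → Finset n)
    (hS : ∀ i, P * U i = U i * diagonal fun k => if k ∈ S i then 1 else 0) (w : ι → n → ℝ)
    (hind : ∀ z : ι → Matrix n n ℝ, (∀ i, (1 - P) * z i * P = z i) →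
      (∀ i k l, w i l ≤ w i k → ((U i)ᵀ * z i * U i) k l = 0) → ∑ i, z i = 0 → z = 0)
    (V : ι → Matrix n n ℝ) (hV : ∀ i, (V i)ᵀ * V i = 1)
    (hsum : ∑ i, V i * diagonal (w i) * (V i)ᵀ = 0) : ∑ i, ∑ k ∈ S i, w i k ≤ 0 := by
  let c : Matrix n n ℝ →+* Matrix n n ℂ := Complex.ofRealHom.mapMatrix
  have hc : ∀ M : Matrix n n ℝ, c M = M.map Complex.ofReal := fun M => rfl
  have hct : ∀ M : Matrix n n ℝ, (c M)ᵀ = c Mᵀ := fun M => rfl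
  have hcd : ∀ d : n → ℝ, c (diagonal d) = diagonal fun k => (d k : ℂ) := fun d => by
    rw [hc, diagonal_map Complex.ofReal_zero]
  have hcH : ∀ M : Matrix n n ℝ, (c M)ᴴ = c Mᵀ := fun M => by
    ext i j; simp [hc, conjTranspose_apply]
  have h1P : c (1 - P) = 1 - c P := by rw [map_sub, map_one]
  obtain ⟨p, hp⟩ := exists_isStarProjection_weighted_trace_le (c P) (by rw [← map_mul, hP])
    (by rw [hct, hPt]) (fun i => c (U i))
    (fun i => by rw [hct, ← map_mul, mul_eq_one_comm.mp (hU i), map_one]) S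
    (fun i => by
      rw [← map_mul, hS, map_mul, hcd, coordProj]
      congr 2
      ext k
      split_ifs <;> simp) w
    (fun z hz hw h0 => by
      have key : ∀ L : ℂ →ₗ[ℝ] ℝ, (fun i => (z i).map L) = 0 := fun L => by
        refine hind _ (fun i => ?_) (fun i k l hkl => ?_) ?_
        · rw [← map_ofReal_mul_mul, ← hc, ← hc, h1P, hz]
        · rw [← map_ofReal_mul_mul, ← hc, ← hc, ← hct, map_apply, hw i k l hkl, map_zero]
        · ext k l
          have := congrArg L (congrFun (congrFun h0 k) l)
          simpa [Matrix.sum_apply] using this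
      ext i k l
      apply Complex.ext
      · exact congrFun (congrFun (congrFun (key Complex.reLm) i) k) l
      · exact congrFun (congrFun (congrFun (key Complex.imLm) i) k) l)
    (fun i => c (V i)) (fun i => by rw [hcH, ← map_mul, hV, map_one])
  calc ∑ i, ∑ k ∈ S i, w i k
      ≤ ∑ i, (p * (c (V i) * diagonal (fun k => (w i k : ℂ)) * (c (V i))ᴴ)).trace.re :=
        Finset.sum_le_sum fun i _ => hp i
    _ = (p * c (∑ i, V i * diagonal (w i) * (V i)ᵀ)).trace.re := by
        rw [map_sum, Finset.mul_sum, trace_sum, Complex.re_sum]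
        simp only [map_mul, hcd, hcH]
    _ = 0 := by rw [hsum, map_zero, mul_zero, trace_zero, Complex.zero_re]

end RealWeights

section MinimalDefect

variable {n : Type*} [Fintype n] [DecidableEq n] {P D a U J : Matrix n n ℝ} {S : Finset n}
  {v w : n → ℝ}

namespace Matrix.IsAdaptedFrame

theorem trace_mul_proj (h : IsAdaptedFrame P D a U S v w) : (a * P).trace = ∑ k ∈ S, v k := by
  have hU' : U * Uᵀ = 1 := mul_eq_one_comm.mp h.orth
  have : a * P = U * (diagonal v * diagonal fun k => if k ∈ S then 1 else 0) * Uᵀ := by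
    calc a * P = a * (P * U) * Uᵀ := by rw [mul_assoc, mul_assoc, hU', mul_one]
      _ = _ := by rw [h.proj_mul_eq, ← mul_assoc, h.mul_eq, mul_assoc U]
  rw [this, trace_mul_comm, ← mul_assoc, h.orth, one_mul, diagonal_mul_diagonal, trace_diagonal]
  simp

theorem defect (h : IsAdaptedFrame P D a U S v w) : IsAdaptedFrame P D D U S w w :=
  ⟨h.orth, h.defect_mul_eq, h.defect_mul_eq, h.proj_mul_eq, h.lt⟩

theorem conj (h : IsAdaptedFrame P D a U S v w) (hJ : Jᵀ * J = 1) (hJP : J * P = P * J)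
    (hJD : J * D = D * J) : IsAdaptedFrame P D (Jᵀ * a * J) (Jᵀ * U) S v w := by
  have hJ' : J * Jᵀ = 1 := mul_eq_one_comm.mp hJ
  have key : ∀ Q : Matrix n n ℝ, J * Q = Q * J → Q * (Jᵀ * U) = Jᵀ * (Q * U) := fun Q hQ => by
    calc Q * (Jᵀ * U) = Jᵀ * (J * Q) * Jᵀ * U := by
          rw [← mul_assoc Jᵀ, hJ, one_mul, mul_assoc]
      _ = Jᵀ * Q * (J * Jᵀ) * U := by rw [hQ]; simp only [mul_assoc]
      _ = _ := by rw [hJ', mul_one, mul_assoc]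
  refine ⟨?_, ?_, ?_, ?_, h.lt⟩
  · rw [transpose_mul, transpose_transpose, mul_assoc, ← mul_assoc J, hJ', one_mul, h.orth]
  · calc Jᵀ * a * J * (Jᵀ * U) = Jᵀ * a * (J * Jᵀ) * U := by simp only [mul_assoc]
      _ = _ := by rw [hJ', mul_one, mul_assoc, h.mul_eq, mul_assoc]
  · rw [key D hJD, h.defect_mul_eq, mul_assoc]
  · rw [key P hJP, h.proj_mul_eq, mul_assoc]

theorem eq_mul_diagonal_mul (h : IsAdaptedFrame P D a U S v w) : U * diagonal v * Uᵀ = a := by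
  rw [← h.mul_eq, mul_assoc, mul_eq_one_comm.mp h.orth, mul_one]

end Matrix.IsAdaptedFrame

/-- If the distance from `C` to the matrices `a + Jᵀ a J` is minimal at `a` along the orthogonal
orbit of `a`, and `C` is a sum of two elements of this orbit, then the distance vanishes. -/
theorem add_conj_eq_of_forall_le {C WA WB : Matrix n n ℝ} (hJ : Jᵀ * J = 1) (hJJ : J * J = -1)
    (ha : aᵀ = a) (hWA : WAᵀ * WA = 1) (hWB : WBᵀ * WB = 1)
    (hC : WA * a * WAᵀ + WB * a * WBᵀ = C) (hJC : J * C = C * J)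
    (hmin : ∀ W : Matrix n n ℝ, Wᵀ * W = 1 → ((a + Jᵀ * a * J - C) * (a + Jᵀ * a * J - C)).trace ≤
      ((W * a * Wᵀ + Jᵀ * (W * a * Wᵀ) * J - C) *
        (W * a * Wᵀ + Jᵀ * (W * a * Wᵀ) * J - C)).trace) :
    a + Jᵀ * a * J = C := by
  have hJ' : J * Jᵀ = 1 := mul_eq_one_comm.mp hJ
  have hJt := transpose_eq_neg hJ hJJ
  obtain ⟨D, hD⟩ : ∃ D, a + Jᵀ * a * J - C = D := ⟨_, rfl⟩
  have hCt : Cᵀ = C := by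
    rw [← hC]
    simp only [transpose_add, transpose_mul, transpose_transpose, ha, mul_assoc]
  have hDt : Dᵀ = D := by
    rw [← hD]
    simp only [transpose_sub, transpose_add, transpose_mul, transpose_transpose, ha, hCt, mul_assoc]
  have hJD : J * D = D * J := by
    have h1 : J * (Jᵀ * a * J) = a * J := by rw [← mul_assoc, ← mul_assoc, hJ', one_mul]
    have h2 : Jᵀ * a * J * J = J * a := by
      rw [mul_assoc, hJJ, hJt]
      noncomm_ring
    rw [← hD, mul_sub, sub_mul, mul_add, add_mul, hJC, h1, h2, add_comm]
  have haD := commute_of_forall_le hJ ha hmin hD hDt hJD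
  have hbD : Jᵀ * a * J * D = D * (Jᵀ * a * J) := by
    have hJtD : Jᵀ * D = D * Jᵀ := by rw [hJt, neg_mul, mul_neg, hJD]
    calc Jᵀ * a * J * D = Jᵀ * a * (J * D) := by rw [mul_assoc]
      _ = Jᵀ * (a * D) * J := by rw [hJD]; simp only [mul_assoc]
      _ = Jᵀ * D * a * J := by rw [haD]; simp only [mul_assoc]
      _ = _ := by rw [hJtD]; simp only [mul_assoc]
  have hCD : C * D = D * C := by
    have : C = a + Jᵀ * a * J - D := by rw [← hD]; abel
    rw [this, sub_mul, mul_sub, add_mul, mul_add, haD, hbD]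
  have htrW : ∀ W : Matrix n n ℝ, Wᵀ * W = 1 → (W * a * Wᵀ).trace = a.trace := fun W hW => by
    rw [trace_mul_comm, ← mul_assoc, hW, one_mul]
  have htr : D.trace = 0 := by
    rw [← hD, ← hC, trace_sub, trace_add, trace_add, htrW _ hWA, htrW _ hWB, trace_mul_comm,
      ← mul_assoc, hJ', one_mul, sub_self]
  by_contra hne
  have hD0 : D ≠ 0 := fun h => hne (sub_eq_zero.mp (hD.trans h))
  obtain ⟨P, UA, UC, SA, SC, vA, wA, vC, wC, hA, hCf, hPt, hPJ, hpos⟩ :=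
    exists_isAdaptedFrame ha hCt hDt haD hCD hD0 htr
  have hJP := hPJ J hJD
  have hB := hA.conj hJ hJP hJD
  have hplus : ∀ u ∈ maskSubmodule UA fun k l => (k ∉ SA ∧ l ∈ SA) ∧ vA k < vA l,
      u + conjLinearMap J u ∈ maskSubmodule UC (fun k l => vC l < vC k) → u = 0 := fun u hu ht =>
    eq_zero_of_add_conj_mem hJ ha hCt hmin hJJ hJC hD hDt hJD hJP hA hCf hu ht
  have horth : ∀ W U : Matrix n n ℝ, Wᵀ * W = 1 → Uᵀ * U = 1 → (W * U)ᵀ * (W * U) = 1 :=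
    fun W U hW hU => by rw [transpose_mul, mul_assoc, ← mul_assoc Wᵀ, hW, one_mul, hU]
  have key := sum_weight_nonpos P hA.proj_mul_self hPt ![UA, Jᵀ * UA, UC]
    (by rw [Fin.forall_fin_succ, Fin.forall_fin_two]; exact ⟨hA.orth, hB.orth, hCf.orth⟩)
    ![SA, SA, SC]
    (by
      rw [Fin.forall_fin_succ, Fin.forall_fin_two]
      exact ⟨hA.proj_mul_eq, hB.proj_mul_eq, hCf.proj_mul_eq⟩)
    ![vA, vA, -vC]
    (fun z hz hw h0 => by
      rw [Fin.sum_univ_three] at h0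
      have hx : z 0 ∈ maskSubmodule UA fun k l => (k ∉ SA ∧ l ∈ SA) ∧ vA k < vA l :=
        mem_maskSubmodule_and (hA.mem_offBlock.mpr (hz 0)) fun k l hkl => hw 0 k l (not_lt.mp hkl)
      have hy : conjLinearMap J (z 1) ∈ maskSubmodule UA
          fun k l => (k ∉ SA ∧ l ∈ SA) ∧ vA k < vA l := by
        refine mem_maskSubmodule_and
          (hA.conjLinearMap_mem_offBlock hJP (hA.mem_offBlock.mpr (hz 1))) fun k l hkl => ?_
        have : (Jᵀ * UA)ᵀ * z 1 * (Jᵀ * UA) = UAᵀ * conjLinearMap J (z 1) * UA := by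
          rw [conjLinearMap_apply, transpose_mul, transpose_transpose]
          simp only [mul_assoc]
        rw [← this]
        exact hw 1 k l (not_lt.mp hkl)
      have hzC : z 2 ∈ maskSubmodule UC fun k l => vC l < vC k := fun k l hkl =>
        hw 2 k l (neg_le_neg (not_lt.mp hkl))
      obtain ⟨h1, h2, h3⟩ := eq_zero_of_add_add_eq_zero hJ hJJ hJC hJP hD hA hCf hplus hx hy hzC h0
      funext i
      revert i
      rw [Fin.forall_fin_succ, Fin.forall_fin_two]
      exact ⟨h1, h2, h3⟩)
    ![WA * UA, WB * UA, UC]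
    (by
      rw [Fin.forall_fin_succ, Fin.forall_fin_two]
      exact ⟨horth _ _ hWA hA.orth, horth _ _ hWB hA.orth, hCf.orth⟩)
    (by
      have hconj : ∀ W : Matrix n n ℝ, W * UA * diagonal vA * (W * UA)ᵀ = W * a * Wᵀ := fun W => by
        rw [← hA.eq_mul_diagonal_mul, transpose_mul]
        simp only [mul_assoc]
      have hdiag : diagonal (-vC) = -diagonal vC := (diagonal_neg vC).symm
      rw [Fin.sum_univ_three]
      change WA * UA * diagonal vA * (WA * UA)ᵀ + WB * UA * diagonal vA * (WB * UA)ᵀ +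
        UC * diagonal (-vC) * UCᵀ = 0
      rw [hconj, hconj, hC, hdiag, mul_neg, neg_mul, hCf.eq_mul_diagonal_mul, add_neg_cancel])
  rw [Fin.sum_univ_three] at key
  change ∑ k ∈ SA, vA k + ∑ k ∈ SA, vA k + ∑ k ∈ SC, -vC k ≤ 0 at key
  rw [Finset.sum_neg_distrib, ← hCf.trace_mul_proj] at key
  nth_rewrite 1 [← hA.trace_mul_proj] at key
  rw [← hB.trace_mul_proj, ← trace_add, ← sub_eq_add_neg, ← trace_sub, ← add_mul, ← sub_mul, hD,
    hA.defect.trace_mul_proj] at key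
  exact absurd hpos (not_lt.mpr key)

end MinimalDefect

section FrequencyForm

variable {n : Type*} [Fintype n] [DecidableEq n]

theorem exists_add_eq_add_conj {s A B J : Matrix n n ℝ} (hs : s.IsSymm) (hA : A.IsSymm)
    (hB : B.IsSymm) (hAs : A.charpoly = s.charpoly) (hBs : B.charpoly = s.charpoly)
    (hJ : Jᵀ * J = 1) (hJJ : J * J = -1) (hJC : J * (A + B) = (A + B) * J) :
    ∃ U : Matrix n n ℝ, Uᵀ * U = 1 ∧ U * s * Uᵀ + Jᵀ * (U * s * Uᵀ) * J = A + B := by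
  let f : Matrix n n ℝ → ℝ := fun U =>
    ((U * s * Uᵀ + Jᵀ * (U * s * Uᵀ) * J - (A + B)) *
      (U * s * Uᵀ + Jᵀ * (U * s * Uᵀ) * J - (A + B))).trace
  have hf : Continuous f := by fun_prop
  obtain ⟨U, hU, hmin⟩ := isCompact_setOf_transpose_mul_self_eq_one.exists_isMinOn
    ⟨1, show (1 : Matrix n n ℝ)ᵀ * 1 = 1 by simp⟩ hf.continuousOn
  replace hU : Uᵀ * U = 1 := hU
  have hU' : U * Uᵀ = 1 := mul_eq_one_comm.mp hU
  obtain ⟨WA, hWA, hAeq⟩ := hA.exists_conjugate_of_charpoly_eq hs hAs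
  obtain ⟨WB, hWB, hBeq⟩ := hB.exists_conjugate_of_charpoly_eq hs hBs
  have horth : ∀ W V : Matrix n n ℝ, Wᵀ * W = 1 → Vᵀ * V = 1 → (W * V)ᵀ * (W * V) = 1 :=
    fun W V hW hV => by rw [transpose_mul, mul_assoc, ← mul_assoc Wᵀ, hW, one_mul, hV]
  have hconj : ∀ W V : Matrix n n ℝ, W * V * s * (W * V)ᵀ = W * (V * s * Vᵀ) * Wᵀ :=
    fun W V => by simp only [transpose_mul, mul_assoc]
  have hcancel : ∀ W : Matrix n n ℝ, W * Uᵀ * (U * s * Uᵀ) * (W * Uᵀ)ᵀ = W * s * Wᵀ :=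
    fun W => by
      rw [← hconj, mul_assoc W, hU, mul_one]
  refine ⟨U, hU, add_conj_eq_of_forall_le (WA := WA * Uᵀ) (WB := WB * Uᵀ) hJ hJJ ?_
    (horth _ _ hWA (by rw [transpose_transpose, hU'])) (horth _ _ hWB
      (by rw [transpose_transpose, hU'])) (by rw [hcancel, hcancel, ← hAeq, ← hBeq]) hJC
    fun W hW => ?_⟩
  · simp only [transpose_mul, transpose_transpose, hs.eq, mul_assoc]
  · have : f U ≤ f (W * U) := hmin (horth W U hW hU)
    simp only [f, hconj] at this
    exact this

theorem Matrix.IsSymm.exists_det_eq_one_conj_eq [Nonempty n] {s U : Matrix n n ℝ} (hs : s.IsSymm)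
    (hU : Uᵀ * U = 1) : ∃ R : Matrix n n ℝ, Rᵀ * R = 1 ∧ R.det = 1 ∧ R * s * Rᵀ = U * s * Uᵀ := by
  have hdet : U.det * U.det = 1 := by
    rw [← det_one (n := n), ← hU, det_mul, det_transpose]
  rcases mul_self_eq_one_iff.mp hdet with h | h
  · exact ⟨U, hU, h, rfl⟩
  obtain ⟨V, v, -, hV, hsv, -⟩ := hs.exists_simultaneous_diagonalization hs rfl
  have hV' : V * Vᵀ = 1 := mul_eq_one_comm.mp hV
  obtain ⟨k⟩ := ‹Nonempty n›
  let d : n → ℝ := Function.update 1 k (-1)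
  have hdd : diagonal d * diagonal d = (1 : Matrix n n ℝ) := by
    rw [diagonal_mul_diagonal, ← diagonal_one]
    congr 1
    ext j
    by_cases hj : j = k <;> simp [d, hj]
  have hs' : s = V * diagonal v * Vᵀ := by rw [← hsv, mul_assoc, hV', mul_one]
  have hdv : diagonal d * diagonal v * diagonal d = diagonal v := by
    rw [mul_assoc, diagonal_mul_diagonal' v d]
    simp only [mul_comm (v _)]
    rw [← diagonal_mul_diagonal', ← mul_assoc, hdd, one_mul]
  refine ⟨U * (V * diagonal d * Vᵀ), ?_, ?_, ?_⟩
  · calc _ = V * diagonal d * Vᵀ * (Uᵀ * U) * (V * diagonal d * Vᵀ) := by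
          simp [transpose_mul, mul_assoc]
      _ = V * (diagonal d * (Vᵀ * V) * diagonal d) * Vᵀ := by
          rw [hU]; simp only [mul_assoc, one_mul]
      _ = 1 := by rw [hV, mul_one, hdd, mul_one, hV']
  · have hVV : V.det * V.det = 1 := by
      rw [← det_one (n := n), ← hV, det_mul, det_transpose]
    have hprod : ∏ j, d j = -1 := by
      simp [d, Finset.prod_update_of_mem]
    rw [det_mul, det_mul, det_mul, det_transpose, det_diagonal, hprod, h]
    linarith
  · calc _ = U * (V * diagonal d * Vᵀ * s * (V * diagonal d * Vᵀ)) * Uᵀ := by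
          simp [transpose_mul, mul_assoc]
      _ = U * (V * (diagonal d * (Vᵀ * V) * diagonal v * (Vᵀ * V) * diagonal d) * Vᵀ) * Uᵀ := by
          rw [hs']; simp only [mul_assoc]
      _ = _ := by rw [hV, mul_one, mul_one, hdv, ← hs']

theorem Matrix.inv_eq_transpose {R : Matrix n n ℝ} (hR : Rᵀ * R = 1) : R⁻¹ = Rᵀ :=
  inv_eq_left_inv hR

end FrequencyForm

/-- Corollary 3 of the paper. Let `S₀` be a real symmetric
`2p × 2p` matrix and let `C = A + B` be a sum of two real symmetric `2p × 2p`
matrices, each having the same ordered spectrum as `S₀` (equivalently, for symmetric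
matrices, the same characteristic polynomial).  Then `C` commutes with some hermitian
structure `J` on `ℝ^{2p}` if and only if there exist `R ∈ SO(2p)` and a hermitian
structure `J̃` such that `C = R (S₀ + J̃⁻¹ S₀ J̃) R⁻¹`. -/
theorem commutes_with_hermitian_structure_iff_conjugate_of_frequency_form
    (p : ℕ) (hp : 1 ≤ p)
    (S₀ : Matrix (Fin (2 * p)) (Fin (2 * p)) ℝ) (hS₀ : S₀.IsSymm)
    (A B : Matrix (Fin (2 * p)) (Fin (2 * p)) ℝ) (hA : A.IsSymm) (hB : B.IsSymm)
    (hAspec : A.charpoly = S₀.charpoly) (hBspec : B.charpoly = S₀.charpoly) :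
    (∃ J : Matrix (Fin (2 * p)) (Fin (2 * p)) ℝ,
        Jᵀ * J = 1 ∧ J * J = -1 ∧ J * (A + B) = (A + B) * J) ↔
    (∃ R J' : Matrix (Fin (2 * p)) (Fin (2 * p)) ℝ,
        Rᵀ * R = 1 ∧ R.det = 1 ∧ J'ᵀ * J' = 1 ∧ J' * J' = -1 ∧
        A + B = R * (S₀ + J'⁻¹ * S₀ * J') * R⁻¹) := by
  have hconj : ∀ R M N : Matrix (Fin (2 * p)) (Fin (2 * p)) ℝ, Rᵀ * R = 1 →
      (R * M * Rᵀ) * (R * N * Rᵀ) = R * (M * N) * Rᵀ := fun R M N hR => by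
    calc _ = R * M * (Rᵀ * R) * N * Rᵀ := by simp only [mul_assoc]
      _ = _ := by rw [hR, mul_one, mul_assoc R]
  constructor
  · rintro ⟨J, hJ, hJJ, hJC⟩
    have : Nonempty (Fin (2 * p)) := ⟨⟨0, by omega⟩⟩
    obtain ⟨U, hU, hUC⟩ := exists_add_eq_add_conj hS₀ hA hB hAspec hBspec hJ hJJ hJC
    obtain ⟨R, hR, hdet, hRU⟩ := hS₀.exists_det_eq_one_conj_eq hU
    have hR' : R * Rᵀ = 1 := mul_eq_one_comm.mp hR
    have hRt : Rᵀᵀ * Rᵀ = 1 := by rw [transpose_transpose, hR']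
    have hJ' : (Rᵀ * J * R)ᵀ = Rᵀ * Jᵀ * R := by
      simp only [transpose_mul, transpose_transpose, mul_assoc]
    have hJ'orth : (Rᵀ * J * R)ᵀ * (Rᵀ * J * R) = 1 := by
      have := hconj Rᵀ Jᵀ J hRt
      rw [transpose_transpose] at this
      rw [hJ', this, hJ, mul_one, hR]
    refine ⟨R, Rᵀ * J * R, hR, hdet, hJ'orth, ?_, ?_⟩
    · have := hconj Rᵀ J J hRt
      rw [transpose_transpose] at this
      rw [this, hJJ, mul_neg, mul_one, neg_mul, hR]
    · rw [inv_eq_transpose hJ'orth, inv_eq_transpose hR, hJ', ← hUC, ← hRU]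
      symm
      calc _ = R * S₀ * Rᵀ + (R * Rᵀ) * Jᵀ * (R * S₀ * Rᵀ) * J * (R * Rᵀ) := by
            simp only [mul_add, add_mul, mul_assoc]
        _ = _ := by rw [hR', one_mul, mul_one]
  · rintro ⟨R, J, hR, -, hJ, hJJ, hC⟩
    have hR' : R * Rᵀ = 1 := mul_eq_one_comm.mp hR
    have hJ' : J * Jᵀ = 1 := mul_eq_one_comm.mp hJ
    have hJt := transpose_eq_neg hJ hJJ
    rw [inv_eq_transpose hJ, inv_eq_transpose hR] at hC
    refine ⟨R * J * Rᵀ, ?_, ?_, ?_⟩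
    · have : (R * J * Rᵀ)ᵀ = R * Jᵀ * Rᵀ := by
        simp only [transpose_mul, transpose_transpose, mul_assoc]
      rw [this, hconj R _ _ hR, hJ, mul_one, hR']
    · rw [hconj R _ _ hR, hJJ, mul_neg, mul_one, neg_mul, hR']
    · rw [hC, hconj R _ _ hR, hconj R _ _ hR]
      congr 2
      have h1 : J * (Jᵀ * S₀ * J) = S₀ * J := by rw [← mul_assoc, ← mul_assoc, hJ', one_mul]
      have h2 : Jᵀ * S₀ * J * J = J * S₀ := by
        rw [mul_assoc, hJJ, hJt]
        noncomm_ring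
      rw [mul_add, add_mul, h1, h2, add_comm]
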